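/- arXiv:1601.05055 — 5 statements merged into one kernel-verified Lean document; each statement's English description precedes it below -/
import Mathlib

section
/- Let u : ℝ × 𝕋 → ℝ be a smooth solution of the Benjamin–Ono equation ∂ₜu + H∂ₓ²u + u∂ₓu = 0 with ∫_𝕋 u(t,x)dx = 0 for all t. Then the functional E₁(u(t)) = ∫_𝕋 (∂ₓu)² dx + (3/4)∫_𝕋 u²·H∂ₓu dx + (1/8)∫_𝕋 u⁴ dx is constant in t. -/
open MeasureTheory Real Function intervalIntegral

/-- The `k`-th Fourier coefficient `f̂(k) = (1/2π)∫_0^{2π} e^{-ikx} f(x) dx` of a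
`2π`-periodic function `f : ℝ → ℝ` (viewed as a function on `𝕋 = ℝ/2πℤ`). -/
noncomputable def fc (f : ℝ → ℝ) (k : ℤ) : ℂ :=
  (1 / (2 * (Real.pi : ℂ))) *
    ∫ x in (0:ℝ)..(2 * Real.pi), Complex.exp (-Complex.I * (k : ℂ) * (x : ℂ)) * (f x : ℂ)

/-- Unnormalised Fourier coefficient of a complex function. -/
noncomputable def ccf (F : ℝ → ℂ) (k : ℤ) : ℂ :=
  ∫ x in (0:ℝ)..(2 * Real.pi), Complex.exp (-Complex.I * (k : ℂ) * (x : ℂ)) * F x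

theorem ccf_ofReal (f : ℝ → ℝ) (k : ℤ) :
    ccf (fun x => (f x : ℂ)) k = 2 * (Real.pi : ℂ) * fc f k := by
  have : (Real.pi : ℂ) ≠ 0 := by exact_mod_cast Real.pi_ne_zero
  unfold ccf fc
  field_simp

theorem ccf_conj (F : ℝ → ℂ) (k : ℤ) :
    ccf (fun x => (starRingEnd ℂ) (F x)) k = (starRingEnd ℂ) (ccf F (-k)) := by
  unfold ccf
  rw [← intervalIntegral_conj]
  apply intervalIntegral.integral_congr
  intro x _
  simp only [map_mul, ← Complex.exp_conj, map_neg, Complex.conj_I, Complex.conj_ofReal]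
  simp

theorem parseval_conj (F G : ℝ → ℂ) (hF : Continuous F) (hG : Continuous G)
    (pF : Periodic F (2 * Real.pi)) (pG : Periodic G (2 * Real.pi)) :
    HasSum (fun k : ℤ => (starRingEnd ℂ) (ccf F k) * ccf G k)
      (2 * (Real.pi : ℂ) * ∫ x in (0:ℝ)..(2 * Real.pi), (starRingEnd ℂ) (F x) * G x) := by
  have : Fact (0 < 2 * Real.pi) := ⟨by positivity⟩
  have hpi : (Real.pi : ℂ) ≠ 0 := by exact_mod_cast Real.pi_ne_zero
  let Fl : C(AddCircle (2 * Real.pi), ℂ) := ⟨pF.lift, continuous_coinduced_dom.mpr hF⟩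
  let Gl : C(AddCircle (2 * Real.pi), ℂ) := ⟨pG.lift, continuous_coinduced_dom.mpr hG⟩
  have key : ∀ (K : ℝ → ℂ) (pK : Periodic K (2 * Real.pi)) (n : ℤ),
      fourierCoeff (T := 2 * Real.pi) (pK.lift) n = (1 / (2 * (Real.pi:ℂ))) * ccf K n := by
    intro K pK n
    rw [fourierCoeff_eq_intervalIntegral _ _ 0, zero_add, ccf, Complex.real_smul]
    push_cast
    congr 1
    apply intervalIntegral.integral_congr
    intro x _
    simp only [fourier_coe_apply, smul_eq_mul]
    rw [Periodic.lift_coe]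
    congr 2
    push_cast
    field_simp
  have h := (fourierBasis (T := 2 * Real.pi)).hasSum_inner_mul_inner
    (ContinuousMap.toLp 2 AddCircle.haarAddCircle ℂ Fl)
    (ContinuousMap.toLp 2 AddCircle.haarAddCircle ℂ Gl)
  rw [ContinuousMap.inner_toLp] at h
  have hint : ∫ x, Gl x * (starRingEnd ℂ) (Fl x) ∂(AddCircle.haarAddCircle (T := 2 * Real.pi))
      = (1 / (2 * (Real.pi:ℂ))) *
        ∫ x in (0:ℝ)..(2 * Real.pi), (starRingEnd ℂ) (F x) * G x := by
    have pK : Periodic (fun x => (starRingEnd ℂ) (F x) * G x) (2 * Real.pi) := by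
      intro x
      simp only [pF x, pG x]
    have := key _ pK 0
    rw [fourierCoeff, ccf] at this
    simp only [neg_zero, Int.cast_zero, mul_zero, zero_mul, Complex.exp_zero, one_mul] at this
    rw [← this]
    congr 1
    ext z
    induction z using QuotientAddGroup.induction_on with
    | H z =>
      simp only [fourier_zero, one_smul]
      rw [Periodic.lift_coe]
      change G z * _ = _
      rw [mul_comm]
      rfl
  rw [hint] at h
  have h2 := h.mul_left ((2 * (Real.pi:ℂ))^2)
  convert! h2 using 1
  · ext k
    rw [← HilbertBasis.repr_apply_apply, fourierBasis_repr, fourierCoeff_toLp,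
      ← inner_conj_symm, ← HilbertBasis.repr_apply_apply, fourierBasis_repr, fourierCoeff_toLp]
    change _ = _ * ((starRingEnd ℂ) (fourierCoeff (pF.lift) k) * fourierCoeff (pG.lift) k)
    rw [key, key]
    simp only [map_mul, map_div₀, map_one, Complex.conj_ofReal, map_ofNat]
    field_simp
  · field_simp

theorem parseval (F G : ℝ → ℂ) (hF : Continuous F) (hG : Continuous G)
    (pF : Periodic F (2 * Real.pi)) (pG : Periodic G (2 * Real.pi)) :
    HasSum (fun k : ℤ => ccf F (-k) * ccf G k)
      (2 * (Real.pi : ℂ) * ∫ x in (0:ℝ)..(2 * Real.pi), F x * G x) := by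
  have := parseval_conj (fun x => (starRingEnd ℂ) (F x)) G (by fun_prop) hG
    (fun x => by simp only [pF x]) pG
  simpa only [ccf_conj, Complex.conj_conj] using this

theorem integral_mul_eq_zero (F G : ℝ → ℂ) (hF : Continuous F) (hG : Continuous G)
    (pF : Periodic F (2 * Real.pi)) (pG : Periodic G (2 * Real.pi))
    (h : ∀ k : ℤ, ccf F (-k) * ccf G k = 0) :
    ∫ x in (0:ℝ)..(2 * Real.pi), F x * G x = 0 := by
  have hs := parseval F G hF hG pF pG
  simp only [h] at hs
  have hpi : (Real.pi : ℂ) ≠ 0 := by exact_mod_cast Real.pi_ne_zero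
  have := hs.unique hasSum_zero
  simpa [hpi] using this

theorem integral_odd_eq_zero (f g : ℝ → ℝ) (hf : Continuous f) (hg : Continuous g)
    (pf : Periodic f (2 * Real.pi)) (pg : Periodic g (2 * Real.pi))
    (m : ℤ → ℂ) (hm : ∀ k, m (-k) = - m k) (h : ∀ k : ℤ, fc g k = m k * fc f k) :
    ∫ x in (0:ℝ)..(2 * Real.pi), f x * g x = 0 := by
  have hs := parseval (fun x => (f x : ℂ)) (fun x => (g x : ℂ)) (by fun_prop) (by fun_prop)
    (fun x => by simp only [pf x]) (fun x => by simp only [pg x])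
  have hs' := (Equiv.neg ℤ).hasSum_iff.mpr hs
  have hneg := hs.neg
  have e : ((fun k : ℤ => ccf (fun x => (f x : ℂ)) (-k) * ccf (fun x => (g x : ℂ)) k) ∘
      (Equiv.neg ℤ)) = fun k : ℤ => -(ccf (fun x => (f x : ℂ)) (-k) * ccf (fun x => (g x : ℂ)) k) := by
    ext k
    simp only [Function.comp, Equiv.neg_apply, ccf_ofReal, h, hm, neg_neg]
    ring
  rw [e] at hs'
  have hz := hs'.unique hneg
  have hpi : (Real.pi : ℂ) ≠ 0 := by exact_mod_cast Real.pi_ne_zero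
  have hz2 : ∫ x in (0:ℝ)..(2 * Real.pi), (f x : ℂ) * (g x : ℂ) = 0 := by
    have := self_eq_neg.mp hz
    simpa [hpi] using this
  simp only [← Complex.ofReal_mul] at hz2
  rw [intervalIntegral.integral_ofReal] at hz2
  exact_mod_cast hz2

theorem eq_zero_of_fc (f : ℝ → ℝ) (hf : Continuous f) (pf : Periodic f (2 * Real.pi))
    (h : ∀ k, fc f k = 0) : f = 0 := by
  have h1 := integral_odd_eq_zero f f hf hf pf pf (fun _ => 0) (by simp) (by simp [h])
  have hpos : (0:ℝ) < 2 * Real.pi := by positivity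
  have h2 : ∀ x ∈ Set.Icc 0 (2 * Real.pi), f x = 0 := by
    by_contra hne
    push Not at hne
    obtain ⟨x, hx, hfx⟩ := hne
    have := intervalIntegral.integral_pos hpos (f := fun x => f x * f x) (by fun_prop)
      (fun y _ => mul_self_nonneg _) ⟨x, hx, mul_self_pos.mpr hfx⟩
    linarith
  ext x
  obtain ⟨y, hy, hxy⟩ := pf.exists_mem_Ico₀ hpos x
  rw [hxy, h2 y ⟨hy.1, hy.2.le⟩]
  rfl

/-- Product of functions with strictly positive frequencies. -/
theorem ccf_mul_pos (F G : ℝ → ℂ) (hF : Continuous F) (hG : Continuous G)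
    (pF : Periodic F (2 * Real.pi)) (pG : Periodic G (2 * Real.pi))
    (zF : ∀ k ≤ 0, ccf F k = 0) (zG : ∀ k ≤ 0, ccf G k = 0) :
    ∀ k ≤ 0, ccf (fun x => F x * G x) k = 0 := by
  intro k hk
  have hc : ∀ j : ℤ, ccf (fun x => Complex.exp (-Complex.I * (k : ℂ) * (x : ℂ)) * G x) j
      = ccf G (k + j) := by
    intro j
    unfold ccf
    apply intervalIntegral.integral_congr
    intro x _
    simp only
    rw [← mul_assoc, ← Complex.exp_add]
    push_cast
    ring_nf
  have := integral_mul_eq_zero F (fun x => Complex.exp (-Complex.I * (k : ℂ) * (x : ℂ)) * G x)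
    hF (by fun_prop) pF (by
      intro x
      simp only [pG x]
      congr 1
      rw [Complex.exp_eq_exp_iff_exists_int]
      exact ⟨-k, by push_cast; ring⟩) (by
      intro j
      rw [hc]
      rcases le_or_gt 0 j with hj | hj
      · rw [zF (-j) (by omega), zero_mul]
      · rw [zG (k + j) (by omega), mul_zero])
  unfold ccf
  rw [← this]
  apply intervalIntegral.integral_congr
  intro x _
  simp only
  ring

theorem cubic_identity (w v : ℝ → ℝ) (hw : Continuous w) (hv : Continuous v)
    (pw : Periodic w (2 * Real.pi)) (pv : Periodic v (2 * Real.pi))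
    (w0 : fc w 0 = 0)
    (h : ∀ k : ℤ, fc v k = -Complex.I * (Int.sign k : ℂ) * fc w k) :
    ∫ x in (0:ℝ)..(2 * Real.pi), (w x ^ 3 - 3 * w x * v x ^ 2) = 0 := by
  let F : ℝ → ℂ := fun x => (w x : ℂ) + Complex.I * (v x : ℂ)
  have hF : Continuous F := by fun_prop
  have pF : Periodic F (2 * Real.pi) := fun x => by simp only [F, pw x, pv x]
  have zF : ∀ k ≤ 0, ccf F k = 0 := by
    intro k hk
    have e : ccf F k = ccf (fun x => (w x : ℂ)) k + Complex.I * ccf (fun x => (v x : ℂ)) k := by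
      unfold ccf
      rw [← intervalIntegral.integral_const_mul, ← intervalIntegral.integral_add]
      · apply intervalIntegral.integral_congr
        intro x _
        simp only [F]
        ring
      · exact Continuous.intervalIntegrable (by fun_prop) _ _
      · exact Continuous.intervalIntegrable (by fun_prop) _ _
    rw [e, ccf_ofReal, ccf_ofReal, h]
    rcases hk.lt_or_eq with hk | hk
    · rw [Int.sign_eq_neg_one_of_neg hk]
      push_cast
      linear_combination (2 * (Real.pi:ℂ) * fc w k) * Complex.I_sq
    · subst hk
      simp [w0]
  have z2 := ccf_mul_pos F F hF hF pF pF zF zF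
  have z3 := ccf_mul_pos F (fun x => F x * F x) hF (by fun_prop) pF
    (fun x => by simp only [pF x]) zF z2 0 le_rfl
  simp only [ccf, Int.cast_zero, mul_zero, zero_mul, Complex.exp_zero, one_mul] at z3
  have hre : ∀ x, (w x ^ 3 - 3 * w x * v x ^ 2) = Complex.reCLM (F x * (F x * F x)) := by
    intro x
    simp [F]
    ring
  simp only [hre]
  rw [ContinuousLinearMap.intervalIntegral_comp_comm, z3]
  · simp
  · exact Continuous.intervalIntegrable (by fun_prop) _ _

theorem fc_deriv (f g : ℝ → ℝ) (hfg : ∀ x, HasDerivAt f (g x) x) (hg : Continuous g)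
    (pf : Periodic f (2 * Real.pi)) (k : ℤ) : fc g k = Complex.I * k * fc f k := by
  have hf : Continuous f := continuous_iff_continuousAt.mpr fun x => (hfg x).continuousAt
  have hE : ∀ x : ℝ, HasDerivAt (fun x : ℝ => Complex.exp (-Complex.I * (k : ℂ) * (x : ℂ)))
      (-Complex.I * k * Complex.exp (-Complex.I * (k : ℂ) * (x : ℂ))) x := by
    intro x
    have h1 : HasDerivAt (fun x : ℝ => -Complex.I * (k : ℂ) * (x : ℂ)) (-Complex.I * k) x := by
      simpa using (Complex.ofRealCLM.hasDerivAt (x := x)).const_mul (-Complex.I * (k:ℂ))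
    simpa [mul_comm] using h1.cexp
  have hI := intervalIntegral.integral_mul_deriv_eq_deriv_mul (a := 0) (b := 2 * Real.pi)
    (u := fun x : ℝ => Complex.exp (-Complex.I * (k : ℂ) * (x : ℂ)))
    (v := fun x => (f x : ℂ)) (v' := fun x => (g x : ℂ))
    (u' := fun x : ℝ => -Complex.I * k * Complex.exp (-Complex.I * (k : ℂ) * (x : ℂ)))
    (fun x _ => hE x) (fun x _ => (hfg x).ofReal_comp)
    (Continuous.intervalIntegrable (by fun_prop) _ _)
    (Continuous.intervalIntegrable (by fun_prop) _ _)
  have hp : f (2 * Real.pi) = f 0 := by simpa using pf 0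
  have he : Complex.exp (-Complex.I * (k : ℂ) * ((2 * Real.pi : ℝ) : ℂ)) = 1 := by
    rw [Complex.exp_eq_one_iff]
    exact ⟨-k, by push_cast; ring⟩
  unfold fc
  rw [hI, hp, he]
  simp only [mul_assoc, intervalIntegral.integral_const_mul]
  simp
  ring

theorem integral_deriv_periodic (f g : ℝ → ℝ) (hfg : ∀ x, HasDerivAt f (g x) x)
    (hg : Continuous g) (pf : Periodic f (2 * Real.pi)) :
    ∫ x in (0:ℝ)..(2 * Real.pi), g x = 0 := by
  rw [intervalIntegral.integral_eq_sub_of_hasDerivAt (fun x _ => hfg x)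
    (hg.intervalIntegrable _ _)]
  have := pf 0
  simp only [zero_add] at this
  linarith

theorem fc_zero (f : ℝ → ℝ) (h : ∫ x in (0:ℝ)..(2 * Real.pi), f x = 0) : fc f 0 = 0 := by
  unfold fc
  simp only [Int.cast_zero, mul_zero, zero_mul, Complex.exp_zero, one_mul]
  rw [intervalIntegral.integral_ofReal, h]
  simp

theorem integral_of_fc_zero (f : ℝ → ℝ) (h : fc f 0 = 0) :
    ∫ x in (0:ℝ)..(2 * Real.pi), f x = 0 := by
  unfold fc at h
  simp only [Int.cast_zero, mul_zero, zero_mul, Complex.exp_zero, one_mul] at h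
  rw [intervalIntegral.integral_ofReal] at h
  have hpi : (Real.pi : ℂ) ≠ 0 := by exact_mod_cast Real.pi_ne_zero
  simpa [hpi] using h

theorem periodic_deriv (f g : ℝ → ℝ) (hfg : ∀ x, HasDerivAt f (g x) x) (c : ℝ)
    (pf : Periodic f c) : Periodic g c := by
  intro x
  have h1 := (hfg (x + c)).comp_add_const x c
  have h2 : (fun y => f (y + c)) = f := funext pf
  rw [h2] at h1
  exact h1.unique (hfg x)

theorem fc_lin (f g : ℝ → ℝ) (hf : Continuous f) (hg : Continuous g) (a b : ℝ) (k : ℤ) :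
    fc (fun x => a * f x + b * g x) k = a * fc f k + b * fc g k := by
  unfold fc
  have : ∫ x in (0:ℝ)..(2 * Real.pi), Complex.exp (-Complex.I * (k : ℂ) * (x : ℂ)) *
      ((a * f x + b * g x : ℝ) : ℂ) =
      a * (∫ x in (0:ℝ)..(2 * Real.pi), Complex.exp (-Complex.I * (k : ℂ) * (x : ℂ)) * (f x : ℂ)) +
      b * (∫ x in (0:ℝ)..(2 * Real.pi), Complex.exp (-Complex.I * (k : ℂ) * (x : ℂ)) * (g x : ℂ)) := by
    rw [← intervalIntegral.integral_const_mul, ← intervalIntegral.integral_const_mul,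
      ← intervalIntegral.integral_add]
    · apply intervalIntegral.integral_congr
      intro x _
      simp only
      push_cast
      ring
    · exact Continuous.intervalIntegrable (by fun_prop) _ _
    · exact Continuous.intervalIntegrable (by fun_prop) _ _
  rw [this]
  ring

theorem sign_sq_mul (k : ℤ) : ((Int.sign k : ℤ) : ℂ) ^ 2 * (k : ℂ) = k := by
  have : (Int.sign k) ^ 2 * k = k := by
    rcases lt_trichotomy k 0 with h | h | h
    · simp [Int.sign_eq_neg_one_of_neg h]
    · simp [h]
    · simp [Int.sign_eq_one_of_pos h]
  exact_mod_cast this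

theorem fixed_time (u w w1 w2 v v1 n n1 r : ℝ → ℝ)
    (du : ∀ x, HasDerivAt u (w x) x) (dw : ∀ x, HasDerivAt w (w1 x) x)
    (dw1 : ∀ x, HasDerivAt w1 (w2 x) x) (dv : ∀ x, HasDerivAt v (v1 x) x)
    (dn : ∀ x, HasDerivAt n (n1 x) x)
    (cw2 : Continuous w2) (cv1 : Continuous v1) (cn1 : Continuous n1) (cr : Continuous r)
    (pu : Periodic u (2 * Real.pi)) (pv : Periodic v (2 * Real.pi))
    (pn : Periodic n (2 * Real.pi)) (pr : Periodic r (2 * Real.pi))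
    (hv : ∀ k : ℤ, fc v k = -Complex.I * (Int.sign k : ℂ) * fc w k)
    (hr : ∀ k : ℤ, fc r k = -Complex.I * (Int.sign k : ℂ) * (Complex.I * k * fc n k))
    (hn : ∀ x, n x = - v1 x - u x * w x) :
    ∫ x in (0:ℝ)..(2 * Real.pi), (2 * w x * n1 x + (3/4) * (2 * u x * n x * v x + u x ^ 2 * r x)
      + (1/8) * (4 * u x ^ 3 * n x)) = 0 := by
  have cont : ∀ f g : ℝ → ℝ, (∀ x, HasDerivAt f (g x) x) → Continuous f := fun f g h =>
    continuous_iff_continuousAt.mpr fun x => (h x).continuousAt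
  have cu := cont _ _ du
  have cw := cont _ _ dw
  have cw1 := cont _ _ dw1
  have cv := cont _ _ dv
  have cn := cont _ _ dn
  have pw := periodic_deriv _ _ du _ pu
  have pw1 := periodic_deriv _ _ dw _ pw
  have pw2 := periodic_deriv _ _ dw1 _ pw1
  have pv1 := periodic_deriv _ _ dv _ pv
  -- exact derivative
  have e1 : ∫ x in (0:ℝ)..(2 * Real.pi),
      (2 * (w1 x * n x + w x * n1 x) + (1/4) * (w x * w x ^ 2 + u x * (2 * w x * w1 x))
       - (3/4) * (w x * v x ^ 2 + u x * (2 * v x * v1 x))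
       + (3/4) * (2 * u x * w x * w1 x + u x ^ 2 * w2 x)
       - (1/2) * (3 * u x ^ 2 * w x * v x + u x ^ 3 * v1 x)
       - (1/10) * (5 * u x ^ 4 * w x)) = 0 := by
    apply integral_deriv_periodic (fun x => 2 * (w x * n x) + (1/4) * (u x * w x ^ 2)
      - (3/4) * (u x * v x ^ 2) + (3/4) * (u x ^ 2 * w1 x) - (1/2) * (u x ^ 3 * v x)
      - (1/10) * u x ^ 5)
    · intro x
      have := ((((((dw x).mul (dn x)).const_mul 2).add
        (((du x).mul ((dw x).pow 2)).const_mul (1/4))).sub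
        (((du x).mul ((dv x).pow 2)).const_mul (3/4))).add
        ((((du x).pow 2).mul (dw1 x)).const_mul (3/4))).sub
        ((((du x).pow 3).mul (dv x)).const_mul (1/2)) |>.sub
        (((du x).pow 5).const_mul (1/10))
      refine this.congr_deriv ?_
      simp only [Pi.pow_apply]
      push_cast
      ring
    · fun_prop
    · intro x
      simp only [pw x, pn x, pu x, pv x, pw1 x]
  have e2 : ∫ x in (0:ℝ)..(2 * Real.pi), w1 x * v1 x = 0 := by
    apply integral_odd_eq_zero w1 v1 cw1 cv1 pw1 pv1 (fun k => -Complex.I * (Int.sign k : ℂ))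
    · intro k
      simp
    · intro k
      rw [fc_deriv v v1 dv cv1 pv, fc_deriv w w1 dw cw1 pw, hv]
      ring
  have e3 := cubic_identity w v cw cv pw pv (by simpa using fc_deriv u w du cw pu 0) hv
  have e4 : ∫ x in (0:ℝ)..(2 * Real.pi), (u x ^ 2) * (1 * r x + (-1) * w2 x) = 0 := by
    apply integral_odd_eq_zero (fun x => u x ^ 2) (fun x => 1 * r x + (-1) * w2 x) (by fun_prop)
      (by fun_prop) (fun x => by simp only [pu x]) (fun x => by simp only [pr x, pw2 x])
      (fun k => -(1/2) * Complex.I * k * k * (Int.sign k : ℂ))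
    · intro k
      simp
    · intro k
      have hq : fc (fun x => 2 * u x * w x) k = Complex.I * k * fc (fun x => u x ^ 2) k := by
        apply fc_deriv
        · intro x
          refine ((du x).pow 2).congr_deriv ?_
          push_cast
          ring
        · fun_prop
        · intro x
          simp only [pu x]
      have hn' : n = fun x => (-1) * v1 x + (-1/2) * (2 * u x * w x) := by
        ext x
        rw [hn x]
        ring
      rw [fc_lin r w2 cr cw2, hr, hn', fc_lin v1 _ cv1 (by fun_prop), hq,
        fc_deriv v v1 dv cv1 pv, fc_deriv w1 w2 dw1 cw2 pw1, fc_deriv w w1 dw cw1 pw, hv]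
      push_cast
      have h1 := sign_sq_mul k
      have h2 := Complex.I_sq
      have h4 : Complex.I ^ 4 = 1 := by rw [Complex.I_pow_four]
      ring_nf
      simp only [h4, h2, Complex.I_pow_three]
      linear_combination (-(k:ℂ) * fc w k) * h1
  have i2 : IntervalIntegrable (fun x => w1 x * v1 x) volume 0 (2 * Real.pi) :=
    Continuous.intervalIntegrable (by fun_prop) _ _
  have i1 : IntervalIntegrable (fun x =>
      (2 * (w1 x * n x + w x * n1 x) + (1/4) * (w x * w x ^ 2 + u x * (2 * w x * w1 x))
       - (3/4) * (w x * v x ^ 2 + u x * (2 * v x * v1 x))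
       + (3/4) * (2 * u x * w x * w1 x + u x ^ 2 * w2 x)
       - (1/2) * (3 * u x ^ 2 * w x * v x + u x ^ 3 * v1 x)
       - (1/10) * (5 * u x ^ 4 * w x))) volume 0 (2 * Real.pi) :=
    Continuous.intervalIntegrable (by fun_prop) _ _
  have i3 : IntervalIntegrable (fun x => w x ^ 3 - 3 * w x * v x ^ 2) volume 0 (2 * Real.pi) :=
    Continuous.intervalIntegrable (by fun_prop) _ _
  have i4 : IntervalIntegrable (fun x => (u x ^ 2) * (1 * r x + (-1) * w2 x)) volume
      0 (2 * Real.pi) :=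
    Continuous.intervalIntegrable (by fun_prop) _ _
  have tot := intervalIntegral.integral_add (i1.add (i2.const_mul 2))
    ((i4.const_mul (3/4)).sub (i3.const_mul (1/4)))
  rw [intervalIntegral.integral_add i1 (i2.const_mul 2),
    intervalIntegral.integral_sub (i4.const_mul (3/4)) (i3.const_mul (1/4)),
    intervalIntegral.integral_const_mul, intervalIntegral.integral_const_mul,
    intervalIntegral.integral_const_mul, e1, e2, e3, e4] at tot
  simp only [mul_zero, add_zero, sub_zero] at tot
  refine Eq.trans ?_ tot
  apply intervalIntegral.integral_congr
  intro x _
  simp only [hn x]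
  ring

theorem hasDerivAt_param {E : Type*} [NormedAddCommGroup E] [NormedSpace ℝ E] [CompleteSpace E]
    (f f' : ℝ → ℝ → E) (a b : ℝ) (hf : ∀ t, Continuous (f t))
    (hf' : Continuous (Function.uncurry f')) (h : ∀ t x, HasDerivAt (fun τ => f τ x) (f' t x) t)
    (t : ℝ) : HasDerivAt (fun τ => ∫ x in a..b, f τ x) (∫ x in a..b, f' t x) t := by
  obtain ⟨C, hC⟩ := ((isCompact_Icc (a := t - 1) (b := t + 1)).prod
    (isCompact_uIcc (a := a) (b := b))).exists_bound_of_continuousOn hf'.continuousOn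
  refine (intervalIntegral.hasDerivAt_integral_of_dominated_loc_of_deriv_le
    (s := Set.Icc (t - 1) (t + 1)) (bound := fun _ => C) (Icc_mem_nhds (by linarith) (by linarith))
    (Filter.Eventually.of_forall fun τ => (hf τ).aestronglyMeasurable)
    ((hf t).intervalIntegrable _ _) ?_ ?_ ?_ ?_).2
  · have : Continuous (f' t) := hf'.comp (by fun_prop : Continuous fun x => (t, x))
    exact this.aestronglyMeasurable
  · exact Filter.Eventually.of_forall fun x hx τ hτ => hC (τ, x) ⟨hτ, Set.uIoc_subset_uIcc hx⟩
  · exact intervalIntegrable_const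
  · exact Filter.Eventually.of_forall fun x hx τ hτ => h τ x

theorem partial_x (f : ℝ × ℝ → ℝ) (hf : ContDiff ℝ (⊤ : ℕ∞) f) (t x : ℝ) :
    HasDerivAt (fun y => f (t, y)) (fderiv ℝ f (t, x) (0, 1)) x := by
  have h := (hf.differentiable (by simp) (t, x)).hasFDerivAt
  exact h.comp_hasDerivAt x ((hasDerivAt_const x t).prodMk (hasDerivAt_id x))

theorem partial_t (f : ℝ × ℝ → ℝ) (hf : ContDiff ℝ (⊤ : ℕ∞) f) (t x : ℝ) :
    HasDerivAt (fun τ => f (τ, x)) (fderiv ℝ f (t, x) (1, 0)) t := by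
  have h := (hf.differentiable (by simp) (t, x)).hasFDerivAt
  exact HasFDerivAt.comp_hasDerivAt (f := fun τ => (τ, x)) t h ((hasDerivAt_id t).prodMk (hasDerivAt_const t x))

theorem smooth_partial (f : ℝ × ℝ → ℝ) (hf : ContDiff ℝ (⊤ : ℕ∞) f) (z : ℝ × ℝ) :
    ContDiff ℝ (⊤ : ℕ∞) (fun p => fderiv ℝ f p z) :=
  (hf.fderiv_right (m := (⊤ : ℕ∞)) (by simp)).clm_apply contDiff_const

theorem partial_comm (f : ℝ × ℝ → ℝ) (hf : ContDiff ℝ (⊤ : ℕ∞) f) (p z y : ℝ × ℝ) :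
    fderiv ℝ (fun p => fderiv ℝ f p z) p y = fderiv ℝ (fun p => fderiv ℝ f p y) p z := by
  have hd : DifferentiableAt ℝ (fderiv ℝ f) p :=
    (hf.fderiv_right (m := (⊤ : ℕ∞)) (by simp)).differentiable (by simp) p
  have hs := (hf.contDiffAt (x := p)).isSymmSndFDerivAt
    (by rw [minSmoothness_of_isRCLikeNormedField]; exact WithTop.coe_le_coe.mpr (le_top : (2 : ℕ∞) ≤ ⊤))
  rw [fderiv_clm_apply hd (by fun_prop), fderiv_clm_apply hd (by fun_prop)]
  simpa using hs y z

theorem hasDerivAt_fc (f f' : ℝ → ℝ → ℝ) (hf : ∀ t, Continuous (f t))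
    (hf' : Continuous (Function.uncurry f')) (h : ∀ t x, HasDerivAt (fun τ => f τ x) (f' t x) t)
    (k : ℤ) (t : ℝ) : HasDerivAt (fun τ => fc (f τ) k) (fc (f' t) k) t := by
  unfold fc
  apply HasDerivAt.const_mul
  apply hasDerivAt_param
    (fun τ x => Complex.exp (-Complex.I * (k : ℂ) * (x : ℂ)) * (f τ x : ℂ))
    (fun τ x => Complex.exp (-Complex.I * (k : ℂ) * (x : ℂ)) * (f' τ x : ℂ))
  · intro τ
    have := hf τ
    fun_prop
  · have h2 : Continuous fun p : ℝ × ℝ => f' p.1 p.2 := hf'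
    change Continuous fun p : ℝ × ℝ =>
      Complex.exp (-Complex.I * (k : ℂ) * (p.2 : ℂ)) * (f' p.1 p.2 : ℂ)
    fun_prop
  · intro τ x
    exact (h τ x).ofReal_comp.const_mul _

/-- **Conservation of `E₁` for the Benjamin–Ono equation.**
Let `u : ℝ × 𝕋 → ℝ` be a smooth solution of `∂ₜu + H∂ₓ²u + u∂ₓu = 0` with
`∫_𝕋 u(t,x) dx = 0` for all `t`.  Here `Hu2 t` (resp. `Hu1 t`) is the Hilbert transform
of `∂ₓ²(u t)` (resp. of `∂ₓ(u t)`). Then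
`E₁(u(t)) = ∫_𝕋 (∂ₓu)² dx + (3/4)∫_𝕋 u²·H∂ₓu dx + (1/8)∫_𝕋 u⁴ dx` is constant in `t`. -/
theorem benjaminOno_E1_conservation
    (u Hu2 Hu1 : ℝ → ℝ → ℝ)
    (hu : ContDiff ℝ (⊤ : ℕ∞) (Function.uncurry u))
    (huper : ∀ t, Periodic (u t) (2 * Real.pi))
    (humean : ∀ t, (∫ x in (0:ℝ)..(2 * Real.pi), u t x) = 0)
    (hH2smooth : ∀ t, ContDiff ℝ (⊤ : ℕ∞) (Hu2 t))
    (hH2per : ∀ t, Periodic (Hu2 t) (2 * Real.pi))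
    (hH2coeff : ∀ t, ∀ k : ℤ, fc (Hu2 t) k =
      -Complex.I * (Int.sign k : ℂ) * fc (iteratedDeriv 2 (u t)) k)
    (hH1smooth : ∀ t, ContDiff ℝ (⊤ : ℕ∞) (Hu1 t))
    (hH1per : ∀ t, Periodic (Hu1 t) (2 * Real.pi))
    (hH1coeff : ∀ t, ∀ k : ℤ, fc (Hu1 t) k =
      -Complex.I * (Int.sign k : ℂ) * fc (deriv (u t)) k)
    (heq : ∀ t x, deriv (fun τ => u τ x) t + Hu2 t x + u t x * deriv (u t) x = 0) :
    ∀ t t' : ℝ,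
      (∫ x in (0:ℝ)..(2 * Real.pi), (deriv (u t) x) ^ 2) +
          (3/4) * (∫ x in (0:ℝ)..(2 * Real.pi), (u t x) ^ 2 * Hu1 t x) +
          (1/8) * ∫ x in (0:ℝ)..(2 * Real.pi), (u t x) ^ 4 =
        (∫ x in (0:ℝ)..(2 * Real.pi), (deriv (u t') x) ^ 2) +
          (3/4) * (∫ x in (0:ℝ)..(2 * Real.pi), (u t' x) ^ 2 * Hu1 t' x) +
          (1/8) * ∫ x in (0:ℝ)..(2 * Real.pi), (u t' x) ^ 4 := by
  -- joint partial derivatives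
  set f : ℝ × ℝ → ℝ := Function.uncurry u with hfdef
  let Ux : ℝ × ℝ → ℝ := fun p => fderiv ℝ f p (0, 1)
  let Ut : ℝ × ℝ → ℝ := fun p => fderiv ℝ f p (1, 0)
  have sUx : ContDiff ℝ (⊤ : ℕ∞) Ux := smooth_partial f hu _
  have sUt : ContDiff ℝ (⊤ : ℕ∞) Ut := smooth_partial f hu _
  let Uxx : ℝ × ℝ → ℝ := fun p => fderiv ℝ Ux p (0, 1)
  have sUxx : ContDiff ℝ (⊤ : ℕ∞) Uxx := smooth_partial Ux sUx _
  let Uxxx : ℝ × ℝ → ℝ := fun p => fderiv ℝ Uxx p (0, 1)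
  have sUxxx : ContDiff ℝ (⊤ : ℕ∞) Uxxx := smooth_partial Uxx sUxx _
  let Utx : ℝ × ℝ → ℝ := fun p => fderiv ℝ Ut p (0, 1)
  have sUtx : ContDiff ℝ (⊤ : ℕ∞) Utx := smooth_partial Ut sUt _
  let N : ℝ × ℝ → ℝ := fun p => - Ut p - f p * Ux p
  have sN : ContDiff ℝ (⊤ : ℕ∞) N := sUt.neg.sub (hu.mul sUx)
  let Nt : ℝ × ℝ → ℝ := fun p => fderiv ℝ N p (1, 0)
  have sNt : ContDiff ℝ (⊤ : ℕ∞) Nt := smooth_partial N sN _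
  have cf := hu.continuous
  have cUx := sUx.continuous
  have cUt := sUt.continuous
  have cUxx := sUxx.continuous
  have cUxxx := sUxxx.continuous
  have cUtx := sUtx.continuous
  have cN := sN.continuous
  have cNt := sNt.continuous
  have du : ∀ t x, HasDerivAt (u t) (Ux (t, x)) x := fun t x => partial_x f hu t x
  have dut : ∀ t x, HasDerivAt (fun τ => u τ x) (Ut (t, x)) t := fun t x => partial_t f hu t x
  have dUx : ∀ t x, HasDerivAt (fun y => Ux (t, y)) (Uxx (t, x)) x :=
    fun t x => partial_x Ux sUx t x
  have dUxx : ∀ t x, HasDerivAt (fun y => Uxx (t, y)) (Uxxx (t, x)) x :=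
    fun t x => partial_x Uxx sUxx t x
  have dUt : ∀ t x, HasDerivAt (fun y => Ut (t, y)) (Utx (t, x)) x :=
    fun t x => partial_x Ut sUt t x
  have dUxt : ∀ t x, HasDerivAt (fun τ => Ux (τ, x)) (Utx (t, x)) t := by
    intro t x
    have := partial_t Ux sUx t x
    rwa [partial_comm f hu (t, x) (0, 1) (1, 0)] at this
  have dNt : ∀ t x, HasDerivAt (fun τ => N (τ, x)) (Nt (t, x)) t :=
    fun t x => partial_t N sN t x
  have hd1 : ∀ t, deriv (u t) = fun x => Ux (t, x) := fun t => funext fun x => (du t x).deriv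
  have hd2 : ∀ t, iteratedDeriv 2 (u t) = fun x => Uxx (t, x) := by
    intro t
    rw [iteratedDeriv_succ, iteratedDeriv_one, hd1]
    exact funext fun x => (dUx t x).deriv
  simp only [hd1, hd2] at hH1coeff hH2coeff heq ⊢
  have hHN : ∀ t x, Hu2 t x = N (t, x) := by
    intro t x
    have := heq t x
    rw [(dut t x).deriv] at this
    change _ = - Ut (t, x) - u t x * Ux (t, x)
    linarith
  have pUx : ∀ t, Periodic (fun x => Ux (t, x)) (2 * Real.pi) := fun t =>
    periodic_deriv _ _ (du t) _ (huper t)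
  -- the derivative of `Hu1` is `Hu2`
  have dV : ∀ t x, HasDerivAt (Hu1 t) (N (t, x)) x := by
    intro t x
    have hd : ∀ x, HasDerivAt (Hu1 t) (deriv (Hu1 t) x) x := fun x =>
      ((hH1smooth t).differentiable (by simp) x).hasDerivAt
    have cd : Continuous (deriv (Hu1 t)) := (hH1smooth t).continuous_deriv (by simp)
    have pd := periodic_deriv _ _ hd _ (hH1per t)
    have cH2 := (hH2smooth t).continuous
    have hz := eq_zero_of_fc (fun x => 1 * deriv (Hu1 t) x + (-1) * Hu2 t x) (by fun_prop)
      (fun x => by simp only [pd x, hH2per t x]) (by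
        intro k
        rw [fc_lin _ _ cd cH2, fc_deriv _ _ hd cd (hH1per t), hH1coeff, hH2coeff,
          fc_deriv (fun x => Ux (t, x)) (fun x => Uxx (t, x)) (dUx t) (by fun_prop) (pUx t)]
        push_cast
        ring)
    have := congrFun hz x
    simp only [Pi.zero_apply] at this
    have e : N (t, x) = deriv (Hu1 t) x := by rw [← hHN]; linarith
    rw [e]
    exact hd x
  -- joint regularity of `Hu1`
  let A : ℝ → ℝ → ℝ := fun t x => ∫ y in (0:ℝ)..x, N (t, y)
  let At : ℝ → ℝ → ℝ := fun t x => ∫ y in (0:ℝ)..x, Nt (t, y)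
  have cA : Continuous (Function.uncurry A) :=
    intervalIntegral.continuous_parametric_primitive_of_continuous (f := fun t y => N (t, y)) cN
  have cAt : Continuous (Function.uncurry At) :=
    intervalIntegral.continuous_parametric_primitive_of_continuous (f := fun t y => Nt (t, y)) cNt
  have dA : ∀ t x, HasDerivAt (fun τ => A τ x) (At t x) t := by
    intro t x
    exact hasDerivAt_param (fun t y => N (t, y)) (fun t y => Nt (t, y)) 0 x
      (fun t => by fun_prop) cNt dNt t
  let VT : ℝ → ℝ → ℝ := fun t x =>
    At t x - (1 / (2 * Real.pi)) * ∫ y in (0:ℝ)..(2 * Real.pi), At t y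
  have hVA : ∀ t x, Hu1 t x = A t x - (1 / (2 * Real.pi)) * ∫ y in (0:ℝ)..(2 * Real.pi), A t y := by
    intro t x
    have hA : ∀ x, A t x = Hu1 t x - Hu1 t 0 := fun x =>
      intervalIntegral.integral_eq_sub_of_hasDerivAt (fun y _ => dV t y)
        (Continuous.intervalIntegrable (by fun_prop) _ _)
    have hm : ∫ y in (0:ℝ)..(2 * Real.pi), Hu1 t y = 0 :=
      integral_of_fc_zero _ (by rw [hH1coeff]; simp)
    simp only [hA]
    rw [intervalIntegral.integral_sub ((hH1smooth t).continuous.intervalIntegrable _ _)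
      intervalIntegrable_const, hm, intervalIntegral.integral_const]
    have := Real.pi_ne_zero
    simp only [smul_eq_mul]
    field_simp
    ring
  have cVT : Continuous (Function.uncurry VT) := by
    have h1 : Continuous fun t => ∫ y in (0:ℝ)..(2 * Real.pi), At t y :=
      intervalIntegral.continuous_parametric_intervalIntegral_of_continuous' cAt _ _
    exact cAt.sub (continuous_const.mul (h1.comp continuous_fst))
  have dVT : ∀ t x, HasDerivAt (fun τ => Hu1 τ x) (VT t x) t := by
    intro t x
    simp only [hVA]
    exact (dA t x).sub (HasDerivAt.const_mul _ (hasDerivAt_param A At 0 (2 * Real.pi)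
      (fun τ => cA.comp (by fun_prop : Continuous fun y => (τ, y))) cAt dA t))
  have pVT : ∀ t, Periodic (VT t) (2 * Real.pi) := by
    intro t x
    have h1 := dVT t (x + 2 * Real.pi)
    simp only [hH1per _ x] at h1
    exact h1.unique (dVT t x)
  have pUt : ∀ t, Periodic (fun x => Ut (t, x)) (2 * Real.pi) := by
    intro t x
    have h1 := dut t (x + 2 * Real.pi)
    simp only [huper _ x] at h1
    exact h1.unique (dut t x)
  have hcu : ∀ t, Continuous (u t) := fun t =>
    cf.comp (by fun_prop : Continuous fun y => (t, y))
  have hr : ∀ t, ∀ k : ℤ, fc (VT t) k =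
      -Complex.I * (Int.sign k : ℂ) * (Complex.I * k * fc (fun x => Ut (t, x)) k) := by
    intro t k
    have h1 := hasDerivAt_fc Hu1 VT (fun t => (hH1smooth t).continuous) cVT dVT k t
    have h2 := hasDerivAt_fc u (fun t x => Ut (t, x)) hcu cUt dut k t
    have h3 : (fun τ => fc (Hu1 τ) k) = fun τ =>
        -Complex.I * (Int.sign k : ℂ) * (Complex.I * k * fc (u τ) k) := by
      ext τ
      rw [hH1coeff, fc_deriv (u τ) (fun x => Ux (τ, x)) (du τ) (by fun_prop) (huper τ)]
    rw [h3] at h1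
    exact h1.unique ((h2.const_mul _).const_mul _)
  -- the energy and its derivative
  let g : ℝ → ℝ → ℝ := fun t x =>
    Ux (t, x) ^ 2 + (3/4) * (u t x ^ 2 * Hu1 t x) + (1/8) * u t x ^ 4
  let g' : ℝ → ℝ → ℝ := fun t x =>
    2 * Ux (t, x) * Utx (t, x) +
      (3/4) * (2 * u t x * Ut (t, x) * Hu1 t x + u t x ^ 2 * VT t x) +
      (1/8) * (4 * u t x ^ 3 * Ut (t, x))
  have cV : Continuous fun p : ℝ × ℝ => Hu1 p.1 p.2 := by
    simp only [hVA]
    have h1 : Continuous fun t => ∫ y in (0:ℝ)..(2 * Real.pi), A t y :=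
      intervalIntegral.continuous_parametric_intervalIntegral_of_continuous' cA _ _
    exact cA.sub (continuous_const.mul (h1.comp continuous_fst))
  have cV1 : ∀ t, Continuous (Hu1 t) := fun t => (hH1smooth t).continuous
  have cu2 : Continuous fun p : ℝ × ℝ => u p.1 p.2 := cf
  have cVT2 : Continuous fun p : ℝ × ℝ => VT p.1 p.2 := cVT
  have hE : ∀ t, HasDerivAt (fun τ => ∫ x in (0:ℝ)..(2 * Real.pi), g τ x) 0 t := by
    intro t
    have h0 : ∫ x in (0:ℝ)..(2 * Real.pi), g' t x = 0 :=
      fixed_time (u t) (fun x => Ux (t, x)) (fun x => Uxx (t, x)) (fun x => Uxxx (t, x))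
        (Hu1 t) (fun x => N (t, x)) (fun x => Ut (t, x)) (fun x => Utx (t, x)) (VT t)
        (du t) (dUx t) (dUxx t) (dV t) (dUt t) (by fun_prop) (by fun_prop) (by fun_prop)
        (cVT.comp (by fun_prop : Continuous fun y => (t, y)))
        (huper t) (hH1per t) (pUt t) (pVT t) (hH1coeff t) (hr t) (by
          intro x
          change Ut (t, x) = -(- Ut (t, x) - u t x * Ux (t, x)) - u t x * Ux (t, x)
          ring)
    refine HasDerivAt.congr_deriv (hasDerivAt_param g g' 0 (2 * Real.pi) ?_ ?_ ?_ t) h0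
    · intro τ
      have := hcu τ
      have := cV1 τ
      fun_prop
    · change Continuous fun p : ℝ × ℝ => 2 * Ux (p.1, p.2) * Utx (p.1, p.2) +
        (3/4) * (2 * u p.1 p.2 * Ut (p.1, p.2) * Hu1 p.1 p.2 + u p.1 p.2 ^ 2 * VT p.1 p.2) +
        (1/8) * (4 * u p.1 p.2 ^ 3 * Ut (p.1, p.2))
      fun_prop
    · intro τ x
      have := (((dUxt τ x).pow 2).add
        ((((dut τ x).pow 2).mul (dVT τ x)).const_mul (3/4))).add
        (((dut τ x).pow 4).const_mul (1/8))
      refine this.congr_deriv ?_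
      simp only [Pi.pow_apply, g']
      push_cast
      ring
  have hsplit : ∀ t, ∫ x in (0:ℝ)..(2 * Real.pi), g t x =
      (∫ x in (0:ℝ)..(2 * Real.pi), (Ux (t, x)) ^ 2) +
          (3/4) * (∫ x in (0:ℝ)..(2 * Real.pi), (u t x) ^ 2 * Hu1 t x) +
          (1/8) * ∫ x in (0:ℝ)..(2 * Real.pi), (u t x) ^ 4 := by
    intro t
    have := hcu t
    have := cV1 t
    have j1 : IntervalIntegrable (fun x => Ux (t, x) ^ 2) volume 0 (2 * Real.pi) :=
      Continuous.intervalIntegrable (by fun_prop) _ _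
    have j2 : IntervalIntegrable (fun x => (3/4) * (u t x ^ 2 * Hu1 t x)) volume 0 (2 * Real.pi) :=
      Continuous.intervalIntegrable (by fun_prop) _ _
    have j3 : IntervalIntegrable (fun x => (1/8) * u t x ^ 4) volume 0 (2 * Real.pi) :=
      Continuous.intervalIntegrable (by fun_prop) _ _
    rw [← intervalIntegral.integral_const_mul, ← intervalIntegral.integral_const_mul,
      ← intervalIntegral.integral_add j1 j2, ← intervalIntegral.integral_add (j1.add j2) j3]
  intro t t'
  rw [← hsplit t, ← hsplit t']
  exact is_const_of_deriv_eq_zero (fun s => (hE s).differentiableAt) (fun s => (hE s).deriv) t t'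
end

section
/- For every ε > 0 there exist a constant C_ε > 0 and an exponent b > 0 such that for every smooth function u : 𝕋 → ℝ with ∫_𝕋 u(x)dx = 0, the directional derivative of E₁ at u in the direction ∂ₓ²u satisfies (d/ds)E₁(u + s∂ₓ²u)|_{s=0} ≤ (−2+ε)‖u‖₂² + C_ε‖u‖(1+‖u‖)^b, where E₁(u) = ∫(∂ₓu)² + (3/4)∫u²·H∂ₓu + (1/8)∫u⁴ (integrals over 𝕋). -/
open MeasureTheory Real Function intervalIntegral

/-- The `L²(𝕋)` norm `‖f‖ = (∫_𝕋 f²)^{1/2}` of a `2π`-periodic function. -/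
noncomputable def l2Norm (f : ℝ → ℝ) : ℝ :=
  Real.sqrt (∫ x in (0:ℝ)..(2 * Real.pi), (f x) ^ 2)

/-- The homogeneous Sobolev norm `‖f‖ₛ = (Σ_{k≠0} |k|^{2s}|f̂(k)|²)^{1/2}`. -/
noncomputable def sobNorm (s : ℝ) (f : ℝ → ℝ) : ℝ :=
  Real.sqrt (∑' k : {k : ℤ // k ≠ 0}, |((k : ℤ) : ℝ)| ^ (2 * s) * ‖fc f (k : ℤ)‖ ^ 2)

lemma aux_cs {f g : ℝ → ℝ} (hf : Continuous f) (hg : Continuous g) :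
    ∫ x in (0:ℝ)..(2 * Real.pi), f x * g x ≤ l2Norm f * l2Norm g := by
  have h2 : (0:ℝ) ≤ 2 * Real.pi := by positivity
  have key : ∀ t : ℝ, 0 ≤ (∫ x in (0:ℝ)..(2 * Real.pi), f x ^ 2) * (t * t)
      + (2 * ∫ x in (0:ℝ)..(2 * Real.pi), f x * g x) * t
      + ∫ x in (0:ℝ)..(2 * Real.pi), g x ^ 2 := by
    intro t
    have h : 0 ≤ ∫ x in (0:ℝ)..(2 * Real.pi), (f x * t + g x) ^ 2 :=
      intervalIntegral.integral_nonneg h2 (fun x _ => sq_nonneg _)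
    have e : ∫ x in (0:ℝ)..(2 * Real.pi), (f x * t + g x) ^ 2 =
        ∫ x in (0:ℝ)..(2 * Real.pi), ((t * t) * f x ^ 2 + (2 * t) * (f x * g x) + g x ^ 2) := by
      congr 1; ext x; ring
    rw [e, intervalIntegral.integral_add, intervalIntegral.integral_add,
      intervalIntegral.integral_const_mul, intervalIntegral.integral_const_mul] at h
    · linarith
    all_goals exact Continuous.intervalIntegrable (by fun_prop) _ _
  have d := discrim_le_zero key
  rw [discrim] at d
  unfold l2Norm
  rw [← Real.sqrt_mul (intervalIntegral.integral_nonneg h2 (fun x _ => sq_nonneg _))]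
  apply Real.le_sqrt_of_sq_le
  linarith

lemma aux_l2_sq (f : ℝ → ℝ) : l2Norm f ^ 2 = ∫ x in (0:ℝ)..(2 * Real.pi), f x ^ 2 :=
  Real.sq_sqrt (intervalIntegral.integral_nonneg (by positivity) (fun x _ => sq_nonneg _))

lemma aux_l2_nonneg (f : ℝ → ℝ) : 0 ≤ l2Norm f := Real.sqrt_nonneg _

lemma aux_l2_abs (f : ℝ → ℝ) : l2Norm (fun x => |f x|) = l2Norm f := by
  simp [l2Norm]

lemma aux_parts {f f' g g' : ℝ → ℝ} (hf : ∀ x, HasDerivAt f (f' x) x)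
    (hg : ∀ x, HasDerivAt g (g' x) x) (cf : Continuous f') (cg : Continuous g')
    (pf : Periodic f (2 * Real.pi)) (pg : Periodic g (2 * Real.pi)) :
    ∫ x in (0:ℝ)..(2 * Real.pi), f x * g' x = - ∫ x in (0:ℝ)..(2 * Real.pi), f' x * g x := by
  rw [intervalIntegral.integral_mul_deriv_eq_deriv_mul (fun x _ => hf x) (fun x _ => hg x)
    (cf.intervalIntegrable _ _) (cg.intervalIntegrable _ _)]
  have h1 := pf 0
  have h2 := pg 0
  rw [zero_add] at h1 h2
  rw [h1, h2]; ring

lemma aux_sup {f f' : ℝ → ℝ} (hf : ∀ x, HasDerivAt f (f' x) x) (cf' : Continuous f')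
    (h0 : ∫ x in (0:ℝ)..(2 * Real.pi), f x = 0) (x : ℝ) (hx : x ∈ Set.Icc (0:ℝ) (2 * Real.pi)) :
    |f x| ≤ Real.sqrt (2 * l2Norm f * l2Norm f') := by
  have cf : Continuous f := continuous_iff_continuousAt.2 fun x => (hf x).continuousAt
  have hpi : (0:ℝ) < 2 * Real.pi := by positivity
  obtain ⟨y, hy, hy0⟩ : ∃ y ∈ Set.Icc (0:ℝ) (2 * Real.pi), f y = 0 := by
    by_contra hne
    push Not at hne
    have hc : ∀ a ∈ Set.Icc (0:ℝ) (2 * Real.pi), ∀ b ∈ Set.Icc (0:ℝ) (2 * Real.pi),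
        f a < 0 → 0 < f b → False := by
      intro a ha b hb h1 h2
      obtain ⟨z, hz, hz0⟩ := (isPreconnected_Icc (a := (0:ℝ)) (b := 2 * Real.pi)).intermediate_value
        ha hb cf.continuousOn ⟨h1.le, h2.le⟩
      exact hne z hz hz0
    have m0 : (0:ℝ) ∈ Set.Icc (0:ℝ) (2 * Real.pi) := ⟨le_rfl, hpi.le⟩
    rcases lt_or_gt_of_ne (hne 0 m0) with h | h
    · have hneg : ∀ z ∈ Set.Icc (0:ℝ) (2 * Real.pi), f z < 0 := fun z hz => by
        rcases lt_or_gt_of_ne (hne z hz) with h' | h'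
        · exact h'
        · exact (hc 0 m0 z hz h h').elim
      have : 0 < ∫ x in (0:ℝ)..(2 * Real.pi), - f x :=
        intervalIntegral.intervalIntegral_pos_of_pos_on (cf.neg.intervalIntegrable _ _)
          (fun z hz => by have := hneg z ⟨hz.1.le, hz.2.le⟩; simpa using this) hpi
      rw [intervalIntegral.integral_neg, h0] at this
      simp at this
    · have hposi : ∀ z ∈ Set.Icc (0:ℝ) (2 * Real.pi), 0 < f z := fun z hz => by
        rcases lt_or_gt_of_ne (hne z hz) with h' | h'
        · exact (hc z hz 0 m0 h' h).elim
        · exact h'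
      have : 0 < ∫ x in (0:ℝ)..(2 * Real.pi), f x :=
        intervalIntegral.intervalIntegral_pos_of_pos_on (cf.intervalIntegrable _ _)
          (fun z hz => hposi z ⟨hz.1.le, hz.2.le⟩) hpi
      rw [h0] at this
      simp at this
  have hFTC : ∫ t in y..x, 2 * (f t * f' t) = f x ^ 2 - f y ^ 2 := by
    apply intervalIntegral.integral_eq_sub_of_hasDerivAt (f := fun t => f t ^ 2)
    · intro t _
      exact ((hf t).fun_pow 2).congr_deriv (by norm_num; ring)
    · exact Continuous.intervalIntegrable (by fun_prop) _ _
  have hb : |∫ t in y..x, 2 * (f t * f' t)| ≤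
      ∫ t in (0:ℝ)..(2 * Real.pi), 2 * (|f t| * |f' t|) := by
    have h1 : ‖∫ t in y..x, 2 * (f t * f' t)‖ ≤ ∫ t in Set.uIoc y x, ‖2 * (f t * f' t)‖ :=
      intervalIntegral.norm_integral_le_integral_norm_uIoc
    have h2 : ∫ t in Set.uIoc y x, ‖2 * (f t * f' t)‖ ≤
        ∫ t in Set.Ioc (0:ℝ) (2 * Real.pi), ‖2 * (f t * f' t)‖ := by
      apply setIntegral_mono_set
      · exact (Continuous.integrableOn_Ioc (by fun_prop))
      · exact Filter.Eventually.of_forall fun t => norm_nonneg _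
      · apply Filter.Eventually.of_forall
        intro t ht
        have ht' : t ∈ Set.Ioc (min y x) (max y x) := ht
        exact ⟨lt_of_le_of_lt (le_min hy.1 hx.1) ht'.1, ht'.2.trans (max_le hy.2 hx.2)⟩
    rw [intervalIntegral.integral_of_le hpi.le]
    rw [Real.norm_eq_abs] at h1
    refine h1.trans (h2.trans (le_of_eq ?_))
    congr 1; ext t; simp
  have hcs := aux_cs (f := fun t => |f t|) (g := fun t => |f' t|) (by fun_prop) (by fun_prop)
  rw [aux_l2_abs, aux_l2_abs] at hcs
  rw [hFTC, intervalIntegral.integral_const_mul, hy0] at hb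
  apply Real.le_sqrt_of_sq_le
  rw [sq_abs]
  have := le_abs_self (f x ^ 2 - 0 ^ 2)
  linarith

lemma aux_fc_eq (f : ℝ → ℝ) (k : ℤ) :
    fc f k = fourierCoeffOn (show (0:ℝ) < 2 * Real.pi by positivity) (fun x => (f x : ℂ)) k := by
  rw [fourierCoeffOn_eq_integral, fc]
  simp only [fourier_coe_apply, smul_eq_mul, Complex.real_smul]
  congr 1
  · push_cast; simp
  · congr 1; ext x; congr 2
    have : (Real.pi : ℂ) ≠ 0 := by exact_mod_cast Real.pi_ne_zero
    push_cast
    field_simp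
    ring

lemma aux_parseval {f : ℝ → ℝ} (hf : Continuous f) :
    HasSum (fun k : ℤ => ‖fc f k‖ ^ 2) ((2 * Real.pi)⁻¹ * l2Norm f ^ 2) := by
  have hpi : (0:ℝ) < 2 * Real.pi := by positivity
  have hm : MemLp (fun x => (f x : ℂ)) 2 (volume.restrict (Set.Ioc 0 (2 * Real.pi))) := by
    have hc : Continuous (fun x => (f x : ℂ)) := by fun_prop
    obtain ⟨B, hB⟩ := isCompact_Icc.exists_bound_of_continuousOn
      (hc.continuousOn (s := Set.Icc 0 (2 * Real.pi)))
    refine MemLp.of_bound hc.aestronglyMeasurable B ?_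
    filter_upwards [ae_restrict_mem measurableSet_Ioc] with x hx
    exact hB x (Set.Ioc_subset_Icc_self hx)
  have h := hasSum_sq_fourierCoeffOn hpi hm
  simp only [← aux_fc_eq] at h
  rw [aux_l2_sq]
  simpa using h

lemma aux_fc_deriv {f f' : ℝ → ℝ} (hf : ∀ x, HasDerivAt f (f' x) x) (cf' : Continuous f')
    (pf : Periodic f (2 * Real.pi)) (k : ℤ) : fc f' k = Complex.I * k * fc f k := by
  unfold fc
  have h1 : ∀ x : ℝ, HasDerivAt (fun x : ℝ => Complex.exp (-Complex.I * (k : ℂ) * (x : ℂ)))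
      (-Complex.I * k * Complex.exp (-Complex.I * (k : ℂ) * (x : ℂ))) x := by
    intro x
    have := (((hasDerivAt_id x).ofReal_comp).const_mul (-Complex.I * (k : ℂ))).cexp
    refine this.congr_deriv ?_
    simp only [id, Complex.ofReal_one]; ring
  have h2 : ∀ x : ℝ, HasDerivAt (fun x : ℝ => (f x : ℂ)) (f' x : ℂ) x :=
    fun x => (hf x).ofReal_comp
  rw [intervalIntegral.integral_mul_deriv_eq_deriv_mul (fun x _ => h1 x) (fun x _ => h2 x)
    (Continuous.intervalIntegrable (by fun_prop) _ _)
    (Continuous.intervalIntegrable (by fun_prop) _ _)]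
  have hp := pf 0
  rw [zero_add] at hp
  have he : Complex.exp (-Complex.I * (k : ℂ) * ((2 * Real.pi : ℝ) : ℂ)) = 1 := by
    rw [Complex.exp_eq_one_iff]
    exact ⟨-k, by push_cast; ring⟩
  rw [he, hp]
  simp only [mul_assoc, intervalIntegral.integral_const_mul]
  simp
  ring

lemma aux_deriv_int {c0 c1 c2 c3 c4 : ℝ → ℝ} (h0 : Continuous c0) (h1 : Continuous c1)
    (h2 : Continuous c2) (h3 : Continuous c3) (h4 : Continuous c4) :
    HasDerivAt (fun s : ℝ => ∫ x in (0:ℝ)..(2 * Real.pi),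
      (c0 x + s * c1 x + s ^ 2 * c2 x + s ^ 3 * c3 x + s ^ 4 * c4 x))
      (∫ x in (0:ℝ)..(2 * Real.pi), c1 x) 0 := by
  have e : (fun s : ℝ => ∫ x in (0:ℝ)..(2 * Real.pi),
      (c0 x + s * c1 x + s ^ 2 * c2 x + s ^ 3 * c3 x + s ^ 4 * c4 x)) =
      fun s : ℝ => (∫ x in (0:ℝ)..(2 * Real.pi), c0 x) + s * (∫ x in (0:ℝ)..(2 * Real.pi), c1 x)
        + s ^ 2 * (∫ x in (0:ℝ)..(2 * Real.pi), c2 x)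
        + s ^ 3 * (∫ x in (0:ℝ)..(2 * Real.pi), c3 x)
        + s ^ 4 * (∫ x in (0:ℝ)..(2 * Real.pi), c4 x) := by
    ext s
    rw [intervalIntegral.integral_add, intervalIntegral.integral_add, intervalIntegral.integral_add,
      intervalIntegral.integral_add]
    · simp only [intervalIntegral.integral_const_mul]
    all_goals exact Continuous.intervalIntegrable (by fun_prop) _ _
  rw [e]
  generalize (∫ x in (0:ℝ)..(2 * Real.pi), c0 x) = a0
  generalize (∫ x in (0:ℝ)..(2 * Real.pi), c1 x) = a1
  generalize (∫ x in (0:ℝ)..(2 * Real.pi), c2 x) = a2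
  generalize (∫ x in (0:ℝ)..(2 * Real.pi), c3 x) = a3
  generalize (∫ x in (0:ℝ)..(2 * Real.pi), c4 x) = a4
  have hid := hasDerivAt_id (0:ℝ)
  have := ((((hid.mul_const a1).const_add a0).add ((hid.fun_pow 2).mul_const a2)).add
    ((hid.fun_pow 3).mul_const a3)).add ((hid.fun_pow 4).mul_const a4)
  exact this.congr_deriv (by norm_num)

/-- bound of a trilinear integral by sup norm and `L²` norms -/
lemma aux_tri {f g h : ℝ → ℝ} (hf : Continuous f) (hg : Continuous g) (hh : Continuous h) {K : ℝ}
    (hK : ∀ x ∈ Set.Icc (0:ℝ) (2 * Real.pi), |f x| ≤ K) :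
    ∫ x in (0:ℝ)..(2 * Real.pi), f x * g x * h x ≤ K * l2Norm g * l2Norm h := by
  have hpi : (0:ℝ) ≤ 2 * Real.pi := by positivity
  have hK0 : 0 ≤ K := (abs_nonneg _).trans (hK 0 ⟨le_rfl, hpi⟩)
  have h1 : ∫ x in (0:ℝ)..(2 * Real.pi), f x * g x * h x ≤
      ∫ x in (0:ℝ)..(2 * Real.pi), K * (|g x| * |h x|) := by
    apply intervalIntegral.integral_mono_on hpi
    · exact Continuous.intervalIntegrable (by fun_prop) _ _
    · exact Continuous.intervalIntegrable (by fun_prop) _ _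
    · intro x hx
      calc f x * g x * h x ≤ |f x * g x * h x| := le_abs_self _
        _ = |f x| * (|g x| * |h x|) := by rw [abs_mul, abs_mul, mul_assoc]
        _ ≤ _ := by gcongr; exact hK x hx
  have hcs := aux_cs (f := fun t => |g t|) (g := fun t => |h t|) (by fun_prop) (by fun_prop)
  rw [aux_l2_abs, aux_l2_abs] at hcs
  rw [intervalIntegral.integral_const_mul] at h1
  calc _ ≤ _ := h1
    _ ≤ K * (l2Norm g * l2Norm h) := by gcongr
    _ = _ := by ring

lemma aux_young {m a Z : ℝ} (hm : 0 ≤ m) (ha : 0 ≤ a)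
    (h : Z ^ 8 ≤ 16 * m ^ 10 * a ^ 14) : 5 * Z ≤ a ^ 2 + 1000000 * m ^ 10 := by
  by_contra hc
  push Not at hc
  have h0 : 0 ≤ a ^ 2 := by positivity
  have h1 : 0 ≤ 1000000 * m ^ 10 := by positivity
  have h2 : (a ^ 2 + 1000000 * m ^ 10) ^ 8 < (5 * Z) ^ 8 :=
    pow_lt_pow_left₀ hc (by positivity) (by norm_num)
  have h3 : 8 * (a ^ 2) ^ 7 * (1000000 * m ^ 10) ≤ (a ^ 2 + 1000000 * m ^ 10) ^ 8 := by
    generalize a ^ 2 = p at *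
    generalize 1000000 * m ^ 10 = q at *
    have : (p + q) ^ 8 - 8 * p ^ 7 * q = p^8 + 28*p^6*q^2 + 56*p^5*q^3 + 70*p^4*q^4
      + 56*p^3*q^5 + 28*p^2*q^6 + 8*p*q^7 + q^8 := by ring
    have : 0 ≤ p^8 + 28*p^6*q^2 + 56*p^5*q^3 + 70*p^4*q^4
      + 56*p^3*q^5 + 28*p^2*q^6 + 8*p*q^7 + q^8 := by positivity
    linarith
  have h4 : (5 * Z) ^ 8 = 390625 * Z ^ 8 := by ring
  have h5 : 8 * (a ^ 2) ^ 7 * (1000000 * m ^ 10) = 8000000 * (m ^ 10 * a ^ 14) := by ring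
  have h6 : 0 ≤ m ^ 10 * a ^ 14 := by positivity
  linarith

lemma aux_num {m p a : ℝ} (hm : 0 ≤ m) (hp : 0 ≤ p) (ha : 0 ≤ a) (h : p ^ 2 ≤ m * a) :
    3 * (Real.sqrt (2 * m * p) * a * p) + (3/2) * (Real.sqrt (2 * p * a) * p * p)
      ≤ a ^ 2 + 1000000 * m ^ 10 := by
  have e1 : (Real.sqrt (2 * m * p) * a * p) ^ 8 = (2 * m * p) ^ 4 * a ^ 8 * p ^ 8 := by
    have : Real.sqrt (2 * m * p) ^ 2 = 2 * m * p := Real.sq_sqrt (by positivity)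
    rw [show (2 * m * p) ^ 4 = (Real.sqrt (2 * m * p) ^ 2) ^ 4 by rw [this]]; ring
  have e2 : (Real.sqrt (2 * p * a) * p * p) ^ 8 = (2 * p * a) ^ 4 * p ^ 16 := by
    have : Real.sqrt (2 * p * a) ^ 2 = 2 * p * a := Real.sq_sqrt (by positivity)
    rw [show (2 * p * a) ^ 4 = (Real.sqrt (2 * p * a) ^ 2) ^ 4 by rw [this]]; ring
  have h1 : 5 * (Real.sqrt (2 * m * p) * a * p) ≤ a ^ 2 + 1000000 * m ^ 10 := by
    apply aux_young hm ha
    rw [e1]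
    calc (2 * m * p) ^ 4 * a ^ 8 * p ^ 8 = 16 * m ^ 4 * a ^ 8 * (p ^ 2) ^ 6 := by ring
      _ ≤ 16 * m ^ 4 * a ^ 8 * (m * a) ^ 6 := by gcongr
      _ = _ := by ring
  have h2 : 5 * (Real.sqrt (2 * p * a) * p * p) ≤ a ^ 2 + 1000000 * m ^ 10 := by
    apply aux_young hm ha
    rw [e2]
    calc (2 * p * a) ^ 4 * p ^ 16 = 16 * a ^ 4 * (p ^ 2) ^ 10 := by ring
      _ ≤ 16 * a ^ 4 * (m * a) ^ 10 := by gcongr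
      _ = _ := by ring
  have : 0 ≤ a ^ 2 + 1000000 * m ^ 10 := by positivity
  linarith

lemma aux_periodic_deriv {f : ℝ → ℝ} {c : ℝ} (h : Periodic f c) : Periodic (deriv f) c := by
  intro x
  rw [← deriv_comp_add_const f c x]
  congr 1
  ext y; exact h y

lemma aux_sob {u u1 u2 : ℝ → ℝ} (h1 : ∀ x, HasDerivAt u (u1 x) x)
    (h2 : ∀ x, HasDerivAt u1 (u2 x) x) (c2 : Continuous u2)
    (p0 : Periodic u (2 * Real.pi)) (p1 : Periodic u1 (2 * Real.pi)) :
    sobNorm 2 u ^ 2 = (2 * Real.pi)⁻¹ * l2Norm u2 ^ 2 := by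
  have c1 : Continuous u1 := continuous_iff_continuousAt.2 fun x => (h2 x).continuousAt
  unfold sobNorm
  rw [Real.sq_sqrt (tsum_nonneg fun k => by positivity), ← (aux_parseval c2).tsum_eq]
  have e : ∀ k : ℤ, ‖fc u2 k‖ ^ 2 = |(k:ℝ)| ^ ((2:ℝ) * 2) * ‖fc u k‖ ^ 2 := by
    intro k
    rw [aux_fc_deriv h2 c2 p1, aux_fc_deriv h1 c1 p0]
    have : |(k:ℝ)| ^ ((2:ℝ) * 2) = |(k:ℝ)| ^ 4 := by
      rw [← Real.rpow_natCast]; norm_num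
    rw [this]
    simp only [norm_mul, Complex.norm_I, Complex.norm_intCast]
    ring
  simp only [e]
  apply tsum_subtype_eq_of_support_subset (s := {k : ℤ | k ≠ 0})
    (f := fun k : ℤ => |(k:ℝ)| ^ ((2:ℝ) * 2) * ‖fc u k‖ ^ 2)
  intro k hk hk0
  apply hk
  have : k = 0 := by simpa using hk0
  subst this
  simp

lemma aux_core {u u1 u2 u3 v w w2 v3 : ℝ → ℝ}
    (h1 : ∀ x, HasDerivAt u (u1 x) x) (h2 : ∀ x, HasDerivAt u1 (u2 x) x)
    (h3 : ∀ x, HasDerivAt u2 (u3 x) x) (c3 : Continuous u3)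
    (hv : ∀ x, HasDerivAt v (w x) x) (hw : ∀ x, HasDerivAt w (w2 x) x) (cw2 : Continuous w2)
    (cv3 : Continuous v3)
    (p0 : Periodic u (2 * Real.pi)) (p1 : Periodic u1 (2 * Real.pi))
    (p2 : Periodic u2 (2 * Real.pi))
    (pv : Periodic v (2 * Real.pi)) (pw : Periodic w (2 * Real.pi))
    (hu0 : (∫ x in (0:ℝ)..(2 * Real.pi), u x) = 0)
    (f1 : ∀ k : ℤ, fc v k = -Complex.I * (Int.sign k : ℂ) * fc u1 k)
    (f3 : ∀ k : ℤ, fc v3 k = -Complex.I * (Int.sign k : ℂ) * fc u3 k) :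
    (∫ x in (0:ℝ)..(2 * Real.pi), 2 * u1 x * u3 x) +
      (3/4) * (∫ x in (0:ℝ)..(2 * Real.pi), (2 * u x * u2 x * v x + u x ^ 2 * v3 x)) +
      (1/8) * (∫ x in (0:ℝ)..(2 * Real.pi), 4 * u x ^ 3 * u2 x) ≤
      - l2Norm u2 ^ 2 + 1000000 * l2Norm u ^ 10 := by
  have hpi : (0:ℝ) < 2 * Real.pi := by positivity
  have c0 : Continuous u := continuous_iff_continuousAt.2 fun x => (h1 x).continuousAt
  have c1 : Continuous u1 := continuous_iff_continuousAt.2 fun x => (h2 x).continuousAt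
  have c2 : Continuous u2 := continuous_iff_continuousAt.2 fun x => (h3 x).continuousAt
  have cv : Continuous v := continuous_iff_continuousAt.2 fun x => (hv x).continuousAt
  have cw : Continuous w := continuous_iff_continuousAt.2 fun x => (hw x).continuousAt
  -- first term
  have T1 : (∫ x in (0:ℝ)..(2 * Real.pi), 2 * u1 x * u3 x) = -2 * l2Norm u2 ^ 2 := by
    simp only [mul_assoc, intervalIntegral.integral_const_mul]
    rw [aux_parts h2 h3 c2 c3 p1 p2, aux_l2_sq]
    simp only [← sq]; ring
  -- last term
  have T4 : (∫ x in (0:ℝ)..(2 * Real.pi), 4 * u x ^ 3 * u2 x) ≤ 0 := by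
    have hd : ∀ x, HasDerivAt (fun x => 4 * u x ^ 3) (12 * u x ^ 2 * u1 x) x := by
      intro x
      exact (((h1 x).fun_pow 3).const_mul 4).congr_deriv (by norm_num; ring)
    rw [aux_parts hd h2 (by fun_prop) c2 (fun x => by simp [p0 x]) p1]
    have : 0 ≤ ∫ x in (0:ℝ)..(2 * Real.pi), 12 * u x ^ 2 * u1 x * u1 x := by
      apply intervalIntegral.integral_nonneg hpi.le
      intro x _
      have : 12 * u x ^ 2 * u1 x * u1 x = 12 * (u x * u1 x) ^ 2 := by ring
      rw [this]; positivity
    linarith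
  -- the Hilbert transform is an isometry and commutes with derivatives
  have hvn : l2Norm v ≤ l2Norm u1 := by
    have hs := hasSum_le (fun k => ?_) (aux_parseval cv) (aux_parseval c1)
    · have : l2Norm v ^ 2 ≤ l2Norm u1 ^ 2 := le_of_mul_le_mul_left hs (by positivity)
      exact (pow_le_pow_iff_left₀ (aux_l2_nonneg _) (aux_l2_nonneg _) (by norm_num)).1 this
    · rw [f1 k]
      have : ‖((Int.sign k : ℤ) : ℂ)‖ ≤ 1 := by
        rcases lt_trichotomy k 0 with h | h | h
        · simp [Int.sign_eq_neg_one_of_neg h]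
        · simp [h]
        · simp [Int.sign_eq_one_of_pos h]
      have h' : ‖-Complex.I * (Int.sign k : ℂ) * fc u1 k‖ ≤ ‖fc u1 k‖ := by
        simp only [norm_mul, norm_neg, Complex.norm_I, one_mul]
        exact mul_le_of_le_one_left (norm_nonneg _) this
      exact pow_le_pow_left₀ (norm_nonneg _) h' 2
  have hfd : ∀ k, fc (fun x => v3 x - w2 x) k = 0 := by
    intro k
    have hsub : fc (fun x => v3 x - w2 x) k = fc v3 k - fc w2 k := by
      unfold fc
      rw [← mul_sub, ← intervalIntegral.integral_sub]
      · congr 2; ext x; push_cast; ring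
      all_goals exact Continuous.intervalIntegrable (by fun_prop) _ _
    rw [hsub, f3 k, aux_fc_deriv hw cw2 pw, aux_fc_deriv hv cw pv, f1 k,
      aux_fc_deriv h3 c3 p2, aux_fc_deriv h2 c2 p1]
    ring
  have hd0 : l2Norm (fun x => v3 x - w2 x) = 0 := by
    have := aux_parseval (f := fun x => v3 x - w2 x) (by fun_prop)
    simp only [hfd] at this
    have h := this.unique (a₂ := 0) (by simp [hasSum_zero])
    have : l2Norm (fun x => v3 x - w2 x) ^ 2 = 0 := by
      rcases mul_eq_zero.1 h with h | h
      · exact absurd h (by positivity)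
      · exact h
    exact pow_eq_zero_iff (by norm_num) |>.1 this
  have T3 : (∫ x in (0:ℝ)..(2 * Real.pi), u x ^ 2 * v3 x) ≤
      ∫ x in (0:ℝ)..(2 * Real.pi), u x ^ 2 * w2 x := by
    have := aux_cs (f := fun x => u x ^ 2) (g := fun x => v3 x - w2 x) (by fun_prop) (by fun_prop)
    rw [hd0, mul_zero] at this
    simp only [mul_sub] at this
    rw [intervalIntegral.integral_sub] at this
    · linarith
    all_goals exact Continuous.intervalIntegrable (by fun_prop) _ _
  have T3' : (∫ x in (0:ℝ)..(2 * Real.pi), u x ^ 2 * w2 x) =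
      2 * (∫ x in (0:ℝ)..(2 * Real.pi), u x * u2 x * v x) +
      2 * (∫ x in (0:ℝ)..(2 * Real.pi), u1 x * u1 x * v x) := by
    have hd1 : ∀ x, HasDerivAt (fun x => u x ^ 2) (2 * u x * u1 x) x := by
      intro x
      exact ((h1 x).fun_pow 2).congr_deriv (by norm_num)
    have hd2 : ∀ x, HasDerivAt (fun x => 2 * u x * u1 x) (2 * u1 x * u1 x + 2 * u x * u2 x) x := by
      intro x
      exact ((h1 x).const_mul 2).mul (h2 x)
    rw [aux_parts hd1 hw (by fun_prop) cw2 (fun x => by simp [p0 x]) pw,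
      aux_parts hd2 hv (by fun_prop) cw (fun x => by simp [p0 x, p1 x]) pv, neg_neg,
      ← intervalIntegral.integral_const_mul, ← intervalIntegral.integral_const_mul,
      ← intervalIntegral.integral_add]
    · congr 1; ext x; ring
    all_goals exact Continuous.intervalIntegrable (by fun_prop) _ _
  have T2 : (∫ x in (0:ℝ)..(2 * Real.pi), (2 * u x * u2 x * v x + u x ^ 2 * v3 x)) =
      2 * (∫ x in (0:ℝ)..(2 * Real.pi), u x * u2 x * v x) +
      ∫ x in (0:ℝ)..(2 * Real.pi), u x ^ 2 * v3 x := by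
    rw [intervalIntegral.integral_add, ← intervalIntegral.integral_const_mul]
    · congr 2; ext x; ring
    all_goals exact Continuous.intervalIntegrable (by fun_prop) _ _
  -- interpolation
  have hint : l2Norm u1 ^ 2 ≤ l2Norm u * l2Norm u2 := by
    have e : l2Norm u1 ^ 2 = ∫ x in (0:ℝ)..(2 * Real.pi), (-u x) * u2 x := by
      rw [aux_parts (fun x => (h1 x).fun_neg) h2 (by fun_prop) c2 (fun x => by simp [p0 x]) p1,
        aux_l2_sq, ← intervalIntegral.integral_neg]
      congr 1; ext x; ring
    rw [e]
    have := aux_cs (f := fun x => - u x) (g := u2) (by fun_prop) c2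
    have hn : l2Norm (fun x => - u x) = l2Norm u := by simp [l2Norm]
    rwa [hn] at this
  have hu10 : (∫ x in (0:ℝ)..(2 * Real.pi), u1 x) = 0 := by
    rw [intervalIntegral.integral_eq_sub_of_hasDerivAt (fun x _ => h1 x)
      (c1.intervalIntegrable _ _)]
    have := p0 0
    rw [zero_add] at this
    rw [this, sub_self]
  have B1 := aux_tri c0 c2 cv (aux_sup h1 c1 hu0)
  have B2 := aux_tri c1 c1 cv (aux_sup h2 c2 hu10)
  have n0 := aux_l2_nonneg u
  have n1 := aux_l2_nonneg u1
  have n2 := aux_l2_nonneg u2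
  have B1' : Real.sqrt (2 * l2Norm u * l2Norm u1) * l2Norm u2 * l2Norm v ≤
      Real.sqrt (2 * l2Norm u * l2Norm u1) * l2Norm u2 * l2Norm u1 := by gcongr
  have B2' : Real.sqrt (2 * l2Norm u1 * l2Norm u2) * l2Norm u1 * l2Norm v ≤
      Real.sqrt (2 * l2Norm u1 * l2Norm u2) * l2Norm u1 * l2Norm u1 := by gcongr
  have N := aux_num n0 n1 n2 hint
  rw [T1, T2]
  linarith

/-- **Dissipation estimate for `E₁`.**  For every `ε > 0` there are `C_ε > 0` and `b > 0`
such that for every smooth mean-zero `u : 𝕋 → ℝ`, the directional derivative of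
`E₁(w) = ∫(∂ₓw)² + (3/4)∫w²·H∂ₓw + (1/8)∫w⁴` at `u` in the direction `∂ₓ²u` satisfies
`(d/ds)E₁(u + s∂ₓ²u)|₀ ≤ (-2+ε)‖u‖₂² + C_ε‖u‖(1+‖u‖)^b`.
Here `v1 = H∂ₓu` and `v3 = H∂ₓ³u` are the Hilbert transforms of the first and third
derivatives of `u` (characterized by their Fourier coefficients), so that
`H∂ₓ(u + s∂ₓ²u) = v1 + s·v3`. -/
theorem E1_directional_derivative_dissipation_bound :
    ∀ ε : ℝ, 0 < ε → ∃ C b : ℝ, 0 < C ∧ 0 < b ∧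
      ∀ u v1 v3 : ℝ → ℝ,
        ContDiff ℝ (⊤ : ℕ∞) u → Periodic u (2 * Real.pi) →
        (∫ x in (0:ℝ)..(2 * Real.pi), u x) = 0 →
        ContDiff ℝ (⊤ : ℕ∞) v1 → Periodic v1 (2 * Real.pi) →
        (∀ k : ℤ, fc v1 k = -Complex.I * (Int.sign k : ℂ) * fc (deriv u) k) →
        ContDiff ℝ (⊤ : ℕ∞) v3 → Periodic v3 (2 * Real.pi) →
        (∀ k : ℤ, fc v3 k = -Complex.I * (Int.sign k : ℂ) * fc (iteratedDeriv 3 u) k) →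
        deriv (fun s : ℝ =>
            (∫ x in (0:ℝ)..(2 * Real.pi), (deriv u x + s * iteratedDeriv 3 u x) ^ 2) +
              (3/4) * (∫ x in (0:ℝ)..(2 * Real.pi),
                (u x + s * iteratedDeriv 2 u x) ^ 2 * (v1 x + s * v3 x)) +
              (1/8) * (∫ x in (0:ℝ)..(2 * Real.pi),
                (u x + s * iteratedDeriv 2 u x) ^ 4)) 0 ≤
          (-2 + ε) * sobNorm 2 u ^ 2 + C * l2Norm u * (1 + l2Norm u) ^ b := by
  intro ε hε
  refine ⟨1000000, 9, by norm_num, by norm_num, ?_⟩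
  intro u v1 v3 hu pu hu0 hv1 pv1 f1 hv3 pv3 f3
  have e2 : iteratedDeriv 2 u = deriv (deriv u) := by
    rw [iteratedDeriv_succ, iteratedDeriv_one]
  have e3 : iteratedDeriv 3 u = deriv (deriv (deriv u)) := by
    rw [iteratedDeriv_succ, e2]
  rw [e3] at f3
  rw [e2, e3]
  have s1 : ContDiff ℝ (⊤ : ℕ∞) (deriv u) := (contDiff_infty_iff_deriv.1 hu).2
  have s2 : ContDiff ℝ (⊤ : ℕ∞) (deriv (deriv u)) := (contDiff_infty_iff_deriv.1 s1).2
  have s3 : ContDiff ℝ (⊤ : ℕ∞) (deriv (deriv (deriv u))) := (contDiff_infty_iff_deriv.1 s2).2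
  have t1 : ContDiff ℝ (⊤ : ℕ∞) (deriv v1) := (contDiff_infty_iff_deriv.1 hv1).2
  have t2 : ContDiff ℝ (⊤ : ℕ∞) (deriv (deriv v1)) := (contDiff_infty_iff_deriv.1 t1).2
  have D : ∀ {f : ℝ → ℝ}, ContDiff ℝ (⊤ : ℕ∞) f → ∀ x, HasDerivAt f (deriv f x) x :=
    fun hf x => ((contDiff_infty_iff_deriv.1 hf).1 x).hasDerivAt
  have p1 := aux_periodic_deriv pu
  have p2 := aux_periodic_deriv p1
  have core := aux_core (D hu) (D s1) (D s2) s3.continuous (D hv1) (D t1) t2.continuous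
    hv3.continuous pu p1 p2 pv1 (aux_periodic_deriv pv1) hu0 f1 f3
  have sob := aux_sob (D hu) (D s1) s2.continuous pu p1
  have c0 := hu.continuous
  have c1 := s1.continuous
  have c2 := s2.continuous
  have c3 := s3.continuous
  have cv := hv1.continuous
  have cv3 := hv3.continuous
  generalize deriv (deriv (deriv u)) = u3 at *
  generalize deriv (deriv u) = u2 at *
  generalize deriv u = u1 at *
  have d1 : HasDerivAt (fun s : ℝ => ∫ x in (0:ℝ)..(2 * Real.pi), (u1 x + s * u3 x) ^ 2)
      (∫ x in (0:ℝ)..(2 * Real.pi), 2 * u1 x * u3 x) 0 := by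
    have := aux_deriv_int (c0 := fun x => u1 x ^ 2) (c1 := fun x => 2 * u1 x * u3 x)
      (c2 := fun x => u3 x ^ 2) (c3 := fun _ => 0) (c4 := fun _ => 0)
      (by fun_prop) (by fun_prop) (by fun_prop) (by fun_prop) (by fun_prop)
    refine this.congr_of_eventuallyEq (Filter.Eventually.of_forall fun s => ?_)
    dsimp only
    congr 1; ext x; ring
  have d2 : HasDerivAt (fun s : ℝ => ∫ x in (0:ℝ)..(2 * Real.pi),
      (u x + s * u2 x) ^ 2 * (v1 x + s * v3 x))
      (∫ x in (0:ℝ)..(2 * Real.pi), (2 * u x * u2 x * v1 x + u x ^ 2 * v3 x)) 0 := by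
    have := aux_deriv_int (c0 := fun x => u x ^ 2 * v1 x)
      (c1 := fun x => 2 * u x * u2 x * v1 x + u x ^ 2 * v3 x)
      (c2 := fun x => u2 x ^ 2 * v1 x + 2 * u x * u2 x * v3 x) (c3 := fun x => u2 x ^ 2 * v3 x)
      (c4 := fun _ => 0)
      (by fun_prop) (by fun_prop) (by fun_prop) (by fun_prop) (by fun_prop)
    refine this.congr_of_eventuallyEq (Filter.Eventually.of_forall fun s => ?_)
    dsimp only
    congr 1; ext x; ring
  have d3 : HasDerivAt (fun s : ℝ => ∫ x in (0:ℝ)..(2 * Real.pi), (u x + s * u2 x) ^ 4)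
      (∫ x in (0:ℝ)..(2 * Real.pi), 4 * u x ^ 3 * u2 x) 0 := by
    have := aux_deriv_int (c0 := fun x => u x ^ 4) (c1 := fun x => 4 * u x ^ 3 * u2 x)
      (c2 := fun x => 6 * u x ^ 2 * u2 x ^ 2) (c3 := fun x => 4 * u x * u2 x ^ 3)
      (c4 := fun x => u2 x ^ 4)
      (by fun_prop) (by fun_prop) (by fun_prop) (by fun_prop) (by fun_prop)
    refine this.congr_of_eventuallyEq (Filter.Eventually.of_forall fun s => ?_)
    dsimp only
    congr 1; ext x; ring
  have hd := ((d1.add (d2.const_mul (3/4))).add (d3.const_mul (1/8))).deriv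
  refine (le_of_eq hd).trans (core.trans ?_)
  have n0 := aux_l2_nonneg u
  have hb : l2Norm u ^ 10 ≤ l2Norm u * (1 + l2Norm u) ^ (9:ℝ) := by
    have : (1 + l2Norm u) ^ (9:ℝ) = (1 + l2Norm u) ^ 9 := by
      rw [← Real.rpow_natCast]; norm_num
    rw [this, pow_succ']
    gcongr
    linarith
  have hS : l2Norm u2 ^ 2 = 2 * Real.pi * sobNorm 2 u ^ 2 := by
    rw [sob]; field_simp
  have hS0 : 0 ≤ sobNorm 2 u ^ 2 := sq_nonneg _
  have hpi := Real.pi_gt_three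
  have h6 : 6 * sobNorm 2 u ^ 2 ≤ l2Norm u2 ^ 2 := by
    rw [hS]; gcongr; linarith
  have h7 : 0 ≤ ε * sobNorm 2 u ^ 2 := by positivity
  linarith
end

section
/- Let n ≥ 2 be an integer and set d = (4n+3)/(2(n+1)) (note d < 2). There is a constant C = C(n) > 0 such that for every smooth function u : 𝕋 → ℝ with ∫_𝕋 u(x)dx = 0, both |∫_𝕋 ∂ₓ²u·∂ₓ^{n−1}u·∂ₓⁿu dx| ≤ C‖u‖_{n+1}^d·‖u‖^{3−d} and |∫_𝕋 ∂ₓu·∂ₓ^{n−1}u·∂ₓ^{n+1}u dx| ≤ C‖u‖_{n+1}^d·‖u‖^{3−d} hold. -/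
open MeasureTheory Real Function intervalIntegral

lemma tre_cs {f g : ℝ → ℝ} (hf : Continuous f) (hg : Continuous g) :
    ∫ x in (0:ℝ)..(2 * Real.pi), |f x| * |g x| ≤ l2Norm f * l2Norm g := by
  have hpi : (0:ℝ) ≤ 2 * Real.pi := by positivity
  set a := ∫ x in (0:ℝ)..(2 * Real.pi), (f x) ^ 2 with ha
  set b := ∫ x in (0:ℝ)..(2 * Real.pi), (g x) ^ 2 with hb
  set c := ∫ x in (0:ℝ)..(2 * Real.pi), |f x| * |g x| with hc
  have key : ∀ t : ℝ, 0 ≤ a * (t * t) + (2 * c) * t + b := by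
    intro t
    have h1 : (∫ x in (0:ℝ)..(2 * Real.pi), (|f x| * t + |g x|) ^ 2)
        = a * (t * t) + (2 * c) * t + b := by
      have : ∀ x, (|f x| * t + |g x|) ^ 2
          = (f x) ^ 2 * (t * t) + (|f x| * |g x|) * (2 * t) + (g x) ^ 2 := by
        intro x
        rw [← sq_abs (f x), ← sq_abs (g x)]; ring
      simp_rw [this]
      rw [intervalIntegral.integral_add, intervalIntegral.integral_add,
        intervalIntegral.integral_mul_const, intervalIntegral.integral_mul_const]
      · ring
      all_goals exact Continuous.intervalIntegrable (by fun_prop) _ _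
    rw [← h1]
    exact intervalIntegral.integral_nonneg hpi (fun x _ => sq_nonneg _)
  have hd := discrim_le_zero key
  rw [discrim] at hd
  have ha0 : 0 ≤ a := intervalIntegral.integral_nonneg hpi (fun x _ => sq_nonneg _)
  unfold l2Norm
  rw [← Real.sqrt_mul ha0]
  apply Real.le_sqrt_of_sq_le
  nlinarith

lemma tre_agmon {f g F : ℝ → ℝ} (hF : ∀ x, HasDerivAt F (f x) x)
    (hFp : F 0 = F (2 * Real.pi)) (hf : ∀ x, HasDerivAt f (g x) x) (hg : Continuous g)
    {x : ℝ} (hx : x ∈ Set.Icc (0:ℝ) (2 * Real.pi)) :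
    |f x| ≤ Real.sqrt (2 * (l2Norm f * l2Norm g)) := by
  have hpi : (0:ℝ) < 2 * Real.pi := by positivity
  have hfc : Continuous f := continuous_iff_continuousAt.2 fun x => (hf x).continuousAt
  obtain ⟨c, hc, hc0⟩ := exists_hasDerivAt_eq_zero (f := F) (f' := f) hpi
    (fun x _ => (hF x).continuousAt.continuousWithinAt) hFp (fun x _ => hF x)
  have h1 : ∫ y in c..x, 2 * f y * g y = f x ^ 2 - f c ^ 2 := by
    rw [← Pi.pow_apply f 2 x, ← Pi.pow_apply f 2 c]
    apply intervalIntegral.integral_eq_sub_of_hasDerivAt (f := f ^ 2)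
    · intro y _
      have := (hf y).pow 2
      simpa using this
    · exact Continuous.intervalIntegrable (by fun_prop) _ _
  rw [hc0] at h1
  apply Real.abs_le_sqrt
  have h2 : |∫ y in c..x, 2 * f y * g y| ≤ ∫ y in (0:ℝ)..(2 * Real.pi), |2 * f y * g y| := by
    have := intervalIntegral.norm_integral_le_integral_norm_uIoc
      (f := fun y => 2 * f y * g y) (a := c) (b := x) (μ := volume)
    simp only [Real.norm_eq_abs] at this
    refine this.trans ?_
    rw [intervalIntegral.integral_of_le hpi.le]
    apply MeasureTheory.setIntegral_mono_set
    · have : IntervalIntegrable (fun y => |2 * f y * g y|) volume 0 (2 * Real.pi) :=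
        Continuous.intervalIntegrable (by fun_prop) _ _
      exact (intervalIntegrable_iff_integrableOn_Ioc_of_le hpi.le).1 this
    · exact Filter.Eventually.of_forall fun y => abs_nonneg _
    · apply HasSubset.Subset.eventuallyLE
      intro y hy
      rw [Set.uIoc, Set.mem_Ioc] at hy
      refine ⟨lt_of_le_of_lt (le_min hc.1.le hx.1) hy.1, hy.2.trans (max_le hc.2.le hx.2)⟩
  have h3 : ∫ y in (0:ℝ)..(2 * Real.pi), |2 * f y * g y|
      = 2 * ∫ y in (0:ℝ)..(2 * Real.pi), |f y| * |g y| := by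
    rw [← intervalIntegral.integral_const_mul]
    congr 1; ext y
    rw [abs_mul, abs_mul]; norm_num; ring
  have h4 := tre_cs hfc hg
  have h5 := le_abs_self (∫ y in c..x, 2 * f y * g y)
  nlinarith

lemma tre_tri {f g h : ℝ → ℝ} {M : ℝ} (hf : Continuous f) (hg : Continuous g) (hh : Continuous h)
    (hM0 : 0 ≤ M) (hM : ∀ x ∈ Set.Icc (0:ℝ) (2 * Real.pi), |f x| ≤ M) :
    |∫ x in (0:ℝ)..(2 * Real.pi), f x * (g x * h x)| ≤ M * (l2Norm g * l2Norm h) := by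
  have hpi : (0:ℝ) ≤ 2 * Real.pi := by positivity
  refine (intervalIntegral.abs_integral_le_integral_abs hpi).trans ?_
  calc ∫ x in (0:ℝ)..(2 * Real.pi), |f x * (g x * h x)|
      ≤ ∫ x in (0:ℝ)..(2 * Real.pi), M * (|g x| * |h x|) := by
        apply intervalIntegral.integral_mono_on hpi
        · exact Continuous.intervalIntegrable (by fun_prop) _ _
        · exact Continuous.intervalIntegrable (by fun_prop) _ _
        · intro x hx
          rw [abs_mul, abs_mul]
          exact mul_le_mul_of_nonneg_right (hM x hx) (by positivity)
    _ = M * ∫ x in (0:ℝ)..(2 * Real.pi), |g x| * |h x| := by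
        rw [intervalIntegral.integral_const_mul]
    _ ≤ _ := mul_le_mul_of_nonneg_left (tre_cs hg hh) hM0

lemma tre_logconv {F f g : ℝ → ℝ} (hF : ∀ x, HasDerivAt F (f x) x)
    (hf : ∀ x, HasDerivAt f (g x) x) (hg : Continuous g)
    (hFp : F (2 * Real.pi) = F 0) (hfp : f (2 * Real.pi) = f 0) :
    l2Norm f ^ 2 ≤ l2Norm F * l2Norm g := by
  have hpi : (0:ℝ) ≤ 2 * Real.pi := by positivity
  have hfc : Continuous f := continuous_iff_continuousAt.2 fun x => (hf x).continuousAt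
  have hFc : Continuous F := continuous_iff_continuousAt.2 fun x => (hF x).continuousAt
  have h0 : l2Norm f ^ 2 = ∫ x in (0:ℝ)..(2 * Real.pi), (f x) ^ 2 :=
    Real.sq_sqrt (intervalIntegral.integral_nonneg hpi (fun x _ => sq_nonneg _))
  have h1 := intervalIntegral.integral_mul_deriv_eq_deriv_mul (a := 0) (b := 2 * Real.pi)
    (u := f) (v := F) (u' := g) (v' := f) (fun x _ => hf x) (fun x _ => hF x)
    (hg.intervalIntegrable _ _) (hfc.intervalIntegrable _ _)
  rw [hFp, hfp, sub_self, zero_sub] at h1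
  have h2 : ∫ x in (0:ℝ)..(2 * Real.pi), (f x) ^ 2 = ∫ x in (0:ℝ)..(2 * Real.pi), f x * f x := by
    congr 1; ext x; ring
  rw [h0, h2, h1]
  refine (neg_le_abs _).trans ((intervalIntegral.abs_integral_le_integral_abs hpi).trans ?_)
  have := tre_cs hFc hg
  refine le_trans (le_of_eq ?_) this
  congr 1
  ext x
  rw [abs_mul, mul_comm]

lemma tre_interp {a : ℕ → ℝ} (h0 : ∀ j, 0 ≤ a j) (h : ∀ j, a (j+1) ^ 2 ≤ a j * a (j+2))
    (j m : ℕ) (hj : j ≤ m) (hm : 0 < m) :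
    a j ≤ a 0 ^ (1 - (j:ℝ) / m) * a m ^ ((j:ℝ) / m) := by
  have P : ∀ j, a j ^ (j+1) ≤ a 0 * a (j+1) ^ j := by
    intro j
    induction j with
    | zero => simp
    | succ j ih =>
      rcases (h0 (j+1)).eq_or_lt with hz | hp
      · rw [← hz, zero_pow (by omega)]
        exact mul_nonneg (h0 _) (pow_nonneg (h0 _) _)
      · have h1 : (a (j+1) ^ 2) ^ (j+1) ≤ (a j * a (j+2)) ^ (j+1) :=
          pow_le_pow_left₀ (sq_nonneg _) (h j) _
        rw [mul_pow] at h1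
        have h2 := mul_le_mul_of_nonneg_right ih (pow_nonneg (h0 (j+2)) (j+1))
        have h3 := h1.trans h2
        have h4 : (0:ℝ) < a (j+1) ^ j := pow_pos hp _
        refine le_of_mul_le_mul_left ?_ h4
        calc a (j+1) ^ j * a (j+1) ^ (j+1+1) = (a (j+1) ^ 2) ^ (j+1) := by ring
          _ ≤ _ := h3
          _ = _ := by ring
  have Q : ∀ m : ℕ, a m ≤ a 0 ^ (1 / ((m:ℝ)+1)) * a (m+1) ^ ((m:ℝ) / ((m:ℝ)+1)) := by
    intro m
    have hm1 : (0:ℝ) < (m:ℝ) + 1 := by positivity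
    have h1 := Real.rpow_le_rpow (pow_nonneg (h0 m) _) (P m) (z := 1 / ((m:ℝ)+1)) (by positivity)
    rw [Real.mul_rpow (h0 0) (pow_nonneg (h0 _) _), ← Real.rpow_natCast, ← Real.rpow_natCast,
      ← Real.rpow_mul (h0 _), ← Real.rpow_mul (h0 _)] at h1
    push_cast at h1
    rw [mul_one_div_cancel hm1.ne', Real.rpow_one, mul_one_div] at h1
    exact h1
  rcases Nat.eq_zero_or_pos j with rfl | hj0
  · simp
  · induction m, hj using Nat.le_induction with
    | base =>
      have : (j:ℝ) ≠ 0 := by positivity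
      simp [div_self this]
    | succ m hjm ih =>
      have hm' : 0 < m := by omega
      have hmR : (0:ℝ) < m := by exact_mod_cast hm'
      have hjR : (j:ℝ) ≤ m := by exact_mod_cast hjm
      have e : (0:ℝ) ≤ 1 - (j:ℝ) / m := by
        rw [sub_nonneg, div_le_one hmR]; exact hjR
      have hq : (0:ℝ) ≤ (j:ℝ) / m := by positivity
      have h1 := Real.rpow_le_rpow (h0 m) (Q m) hq
      rw [Real.mul_rpow (Real.rpow_nonneg (h0 _) _) (Real.rpow_nonneg (h0 _) _),
        ← Real.rpow_mul (h0 _), ← Real.rpow_mul (h0 _)] at h1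
      refine (ih hm').trans ?_
      refine (mul_le_mul_of_nonneg_left h1 (Real.rpow_nonneg (h0 _) _)).trans ?_
      rw [← mul_assoc, ← Real.rpow_add_of_nonneg (h0 0) e (by positivity)]
      apply le_of_eq
      push_cast
      congr 2
      · field_simp; ring
      · field_simp

lemma tre_fc_deriv {f g : ℝ → ℝ} (hf : ∀ x, HasDerivAt f (g x) x) (hg : Continuous g)
    (hp : f (2 * Real.pi) = f 0) (k : ℤ) : fc g k = (Complex.I * k) * fc f k := by
  unfold fc
  have he : ∀ x : ℝ, HasDerivAt (fun x : ℝ => Complex.exp (-Complex.I * (k : ℂ) * (x : ℂ)))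
      (Complex.exp (-Complex.I * (k : ℂ) * (x : ℂ)) * (-Complex.I * (k : ℂ))) x := by
    intro x
    have h1 : HasDerivAt (fun x : ℝ => -Complex.I * (k : ℂ) * (x : ℂ)) (-Complex.I * (k : ℂ)) x := by
      simpa using (Complex.ofRealCLM.hasDerivAt (x := x)).const_mul (-Complex.I * (k : ℂ))
    exact h1.cexp
  have h1 := intervalIntegral.integral_mul_deriv_eq_deriv_mul (a := 0) (b := 2 * Real.pi)
    (v := fun x => (f x : ℂ)) (v' := fun x => (g x : ℂ)) (fun x _ => he x)
    (fun x _ => (hf x).ofReal_comp)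
    (Continuous.intervalIntegrable (by fun_prop) _ _)
    (Continuous.intervalIntegrable (by fun_prop) _ _)
  rw [h1]
  have h2 : Complex.exp (-Complex.I * (k : ℂ) * ((2 * Real.pi : ℝ) : ℂ)) = 1 := by
    rw [Complex.exp_eq_one_iff]
    refine ⟨-k, ?_⟩
    push_cast; ring
  rw [h2, hp]
  have h3 : ∀ x : ℝ, Complex.exp (-Complex.I * (k : ℂ) * (x : ℂ)) * (-Complex.I * (k : ℂ)) * (f x : ℂ)
     = (-Complex.I * (k : ℂ)) * (Complex.exp (-Complex.I * (k : ℂ) * (x : ℂ)) * (f x : ℂ)) := by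
    intro x; ring
  simp_rw [h3]
  rw [intervalIntegral.integral_const_mul]
  simp
  ring

lemma tre_parseval {f : ℝ → ℝ} (hf : Continuous f) :
    HasSum (fun k : ℤ => ‖fc f k‖ ^ 2)
      ((2 * Real.pi)⁻¹ * ∫ x in (0:ℝ)..(2 * Real.pi), (f x) ^ 2) := by
  have hpi : (0:ℝ) < 2 * Real.pi := by positivity
  have hL : MemLp (fun x => (f x : ℂ)) 2 (volume.restrict (Set.Ioc 0 (2 * Real.pi))) := by
    have hc : Continuous (fun x => (f x : ℂ)) := by fun_prop
    obtain ⟨B, hB⟩ := (isCompact_Icc (a := (0:ℝ)) (b := 2 * Real.pi)).exists_bound_of_continuousOn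
      hc.continuousOn
    refine MemLp.of_bound hc.aestronglyMeasurable B ?_
    filter_upwards [ae_restrict_mem measurableSet_Ioc] with x hx
    exact hB x ⟨hx.1.le, hx.2⟩
  have h := hasSum_sq_fourierCoeffOn hpi hL
  convert h using 1
  · ext k
    congr 2
    rw [fourierCoeffOn_eq_integral]
    unfold fc
    rw [Complex.real_smul]
    congr 1
    · simp
    · apply intervalIntegral.integral_congr
      intro x _
      simp only [smul_eq_mul]
      rw [fourier_coe_apply]
      congr 2
      have : (Real.pi : ℂ) ≠ 0 := by exact_mod_cast Real.pi_ne_zero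
      push_cast
      field_simp
      simp
      ring
  · simp

lemma tre_sob {u : ℝ → ℝ} {D : ℕ → ℝ → ℝ} (hD0 : D 0 = u)
    (hD : ∀ j x, HasDerivAt (D j) (D (j+1) x) x) (hp : ∀ j, D j (2 * Real.pi) = D j 0) (n : ℕ) :
    l2Norm (D (n+1)) = Real.sqrt (2 * Real.pi) * sobNorm ((n:ℝ)+1) u := by
  have hpi : (0:ℝ) < 2 * Real.pi := by positivity
  have hDc : ∀ j, Continuous (D j) :=
    fun j => continuous_iff_continuousAt.2 fun x => (hD j x).continuousAt
  have h1 : ∀ j k, fc (D j) k = (Complex.I * k) ^ j * fc u k := by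
    intro j k
    induction j with
    | zero => simp [hD0]
    | succ j ih => rw [tre_fc_deriv (hD j) (hDc _) (hp j), ih]; ring
  have h2 := (tre_parseval (hDc (n+1))).tsum_eq
  have h3 : ∑' k : {k : ℤ // k ≠ 0}, |((k : ℤ) : ℝ)| ^ (2 * ((n:ℝ)+1)) * ‖fc u (k : ℤ)‖ ^ 2
      = ∑' k : ℤ, ‖fc (D (n+1)) k‖ ^ 2 := by
    rw [← tsum_subtype_eq_of_support_subset (s := {k : ℤ | k ≠ 0})]
    · apply tsum_congr
      intro k
      rw [h1, norm_mul, norm_pow, norm_mul, Complex.norm_I, one_mul, Complex.norm_intCast, mul_pow,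
        ← pow_mul]
      congr 1
      rw [← Real.rpow_natCast]
      congr 1
      push_cast; ring
    · intro k hk hk0
      apply hk
      simp [h1, hk0]
  unfold sobNorm l2Norm
  rw [h3, h2, ← Real.sqrt_mul hpi.le]
  congr 1
  field_simp

lemma tre_comb {S T x y z w a b c e N : ℝ} (hS : 0 ≤ S) (hT : 0 ≤ T)
    (hN : 0 < N) (ha : 0 ≤ a) (hb : 0 ≤ b) (hc : 0 ≤ c) (he : 0 ≤ e)
    (ha' : a ≤ N) (hb' : b ≤ N) (hc' : c ≤ N) (he' : e ≤ N)
    (hx0 : 0 ≤ x) (hy0 : 0 ≤ y) (hz0 : 0 ≤ z) (hw0 : 0 ≤ w)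
    (hx : x ≤ T ^ (1 - a / N) * S ^ (a / N)) (hy : y ≤ T ^ (1 - b / N) * S ^ (b / N))
    (hz : z ≤ T ^ (1 - c / N) * S ^ (c / N)) (hw : w ≤ T ^ (1 - e / N) * S ^ (e / N))
    (d : ℝ) (hd : d = (a / 2 + b / 2 + c + e) / N) :
    Real.sqrt (2 * (x * y)) * (z * w) ≤ 2 * (S ^ d * T ^ (3 - d)) := by
  have A : ∀ t, t ≤ N → 0 ≤ 1 - t / N := fun t ht => by
    rw [sub_nonneg, div_le_one hN]; exact ht
  have Sn : ∀ t : ℝ, 0 ≤ S ^ t := fun t => Real.rpow_nonneg hS t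
  have Tn : ∀ t : ℝ, 0 ≤ T ^ t := fun t => Real.rpow_nonneg hT t
  have hxy : Real.sqrt (x * y) ≤ T ^ ((1 - a / N) / 2 + (1 - b / N) / 2) * S ^ (a / N / 2 + b / N / 2) := by
    have h1 : x * y ≤ (T ^ ((1 - a / N) / 2 + (1 - b / N) / 2) * S ^ (a / N / 2 + b / N / 2)) ^ 2 := by
      refine (mul_le_mul hx hy hy0 (mul_nonneg (Tn _) (Sn _))).trans (le_of_eq ?_)
      rw [mul_pow, ← Real.rpow_natCast, ← Real.rpow_natCast, ← Real.rpow_mul hT, ← Real.rpow_mul hS]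
      have e1 : ((1 - a / N) / 2 + (1 - b / N) / 2) * ((2:ℕ):ℝ) = (1 - a / N) + (1 - b / N) := by
        push_cast; ring
      have e2 : (a / N / 2 + b / N / 2) * ((2:ℕ):ℝ) = a / N + b / N := by
        push_cast; ring
      rw [e1, e2, Real.rpow_add_of_nonneg hT (A a ha') (A b hb'),
        Real.rpow_add_of_nonneg hS (by positivity) (by positivity)]
      ring
    exact Real.sqrt_le_iff.2 ⟨mul_nonneg (Tn _) (Sn _), h1⟩
  have h2 : Real.sqrt 2 ≤ 2 := Real.sqrt_le_iff.2 (by norm_num)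
  rw [Real.sqrt_mul (by norm_num), mul_assoc]
  refine mul_le_mul h2 ?_ (by positivity) (by norm_num)
  refine (mul_le_mul hxy (mul_le_mul hz hw hw0 (mul_nonneg (Tn _) (Sn _))) (by positivity)
    (mul_nonneg (Tn _) (Sn _))).trans (le_of_eq ?_)
  have f1 : d = (a / N / 2 + b / N / 2) + (c / N + e / N) := by rw [hd]; field_simp; ring
  have f2 : 3 - d = ((1 - a / N) / 2 + (1 - b / N) / 2) + ((1 - c / N) + (1 - e / N)) := by
    rw [f1]; ring
  have p1 := A a ha'
  have p2 := A b hb'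
  have p3 := A c hc'
  have p4 := A e he'
  rw [f2, Real.rpow_add_of_nonneg hT (y := (1 - a / N) / 2 + (1 - b / N) / 2)
      (z := (1 - c / N) + (1 - e / N)) (by positivity) (by positivity),
    Real.rpow_add_of_nonneg hT p3 p4, f1,
    Real.rpow_add_of_nonneg hS (y := a / N / 2 + b / N / 2) (z := c / N + e / N)
      (by positivity) (by positivity),
    Real.rpow_add_of_nonneg hS (y := c / N) (z := e / N) (by positivity) (by positivity)]
  ring

/-- **Trilinear estimates for the remainder of `Eₙ`.**  Let `n ≥ 2` and
`d = (4n+3)/(2(n+1)) < 2`.  There is `C = C(n) > 0` such that for every smooth mean-zero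
`u : 𝕋 → ℝ`, both `|∫ ∂ₓ²u·∂ₓ^{n-1}u·∂ₓⁿu| ≤ C‖u‖_{n+1}^d‖u‖^{3-d}` and
`|∫ ∂ₓu·∂ₓ^{n-1}u·∂ₓ^{n+1}u| ≤ C‖u‖_{n+1}^d‖u‖^{3-d}`. -/
theorem trilinear_remainder_estimates (n : ℕ) (hn : 2 ≤ n) :
    ∃ C : ℝ, 0 < C ∧
      ∀ u : ℝ → ℝ,
        ContDiff ℝ (⊤ : ℕ∞) u → Periodic u (2 * Real.pi) →
        (∫ x in (0:ℝ)..(2 * Real.pi), u x) = 0 →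
        |∫ x in (0:ℝ)..(2 * Real.pi),
            iteratedDeriv 2 u x * iteratedDeriv (n - 1) u x * iteratedDeriv n u x| ≤
          C * sobNorm ((n : ℝ) + 1) u ^ ((4 * (n : ℝ) + 3) / (2 * ((n : ℝ) + 1))) *
            l2Norm u ^ (3 - (4 * (n : ℝ) + 3) / (2 * ((n : ℝ) + 1))) ∧
        |∫ x in (0:ℝ)..(2 * Real.pi),
            deriv u x * iteratedDeriv (n - 1) u x * iteratedDeriv (n + 1) u x| ≤
          C * sobNorm ((n : ℝ) + 1) u ^ ((4 * (n : ℝ) + 3) / (2 * ((n : ℝ) + 1))) *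
            l2Norm u ^ (3 - (4 * (n : ℝ) + 3) / (2 * ((n : ℝ) + 1))) := by
  obtain ⟨p, rfl⟩ : ∃ p, n = p + 2 := ⟨n - 2, by omega⟩
  set N : ℝ := ((p + 2 : ℕ) : ℝ) + 1 with hN
  set d : ℝ := (4 * ((p + 2 : ℕ) : ℝ) + 3) / (2 * N) with hd
  refine ⟨2 * Real.sqrt (2 * Real.pi) ^ d, by positivity, ?_⟩
  intro u hu hper _
  have hD : ∀ j x, HasDerivAt (iteratedDeriv j u) (iteratedDeriv (j+1) u x) x := by
    intro j x
    rw [iteratedDeriv_succ]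
    exact ((hu.differentiable_iteratedDeriv j (by exact_mod_cast ENat.coe_lt_top j)) x).hasDerivAt
  have hp : ∀ j, iteratedDeriv j u (2 * Real.pi) = iteratedDeriv j u 0 := by
    intro j
    have h1 := iteratedDeriv_comp_add_const j u (2 * Real.pi)
    have h2 : (fun z => u (z + 2 * Real.pi)) = u := funext hper
    rw [h2] at h1
    have h3 := congrFun h1 0
    simpa using h3.symm
  have hDc : ∀ j, Continuous (iteratedDeriv j u) :=
    fun j => continuous_iff_continuousAt.2 fun x => (hD j x).continuousAt
  have hn0 : ∀ f : ℝ → ℝ, 0 ≤ l2Norm f := fun f => Real.sqrt_nonneg _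
  have hint := fun j hj => tre_interp (a := fun j => l2Norm (iteratedDeriv j u)) (fun j => hn0 _)
    (fun j => tre_logconv (hD j) (hD (j+1)) (hDc _) (hp j) (hp (j+1))) j (p + 3) hj (by omega)
  have hsob := tre_sob (D := fun j => iteratedDeriv j u) iteratedDeriv_zero hD hp (p + 2)
  simp only [iteratedDeriv_zero] at hint
  have hNe : ((p + 3 : ℕ) : ℝ) = N := by rw [hN]; push_cast; ring
  have hNp : (0:ℝ) < N := by positivity
  rw [hNe] at hint
  have hs0 : 0 ≤ sobNorm N u := Real.sqrt_nonneg _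
  have hfin : ∀ I : ℝ, I ≤ 2 * (l2Norm (iteratedDeriv (p+3) u) ^ d * l2Norm u ^ (3 - d)) →
      I ≤ 2 * Real.sqrt (2 * Real.pi) ^ d * sobNorm N u ^ d * l2Norm u ^ (3 - d) := by
    intro I hI
    refine hI.trans (le_of_eq ?_)
    have : l2Norm (iteratedDeriv (p+3) u) = Real.sqrt (2 * Real.pi) * sobNorm N u := hsob
    rw [this, Real.mul_rpow (Real.sqrt_nonneg _) hs0]
    ring
  have hle : ∀ j : ℕ, j ≤ p + 3 → (j : ℝ) ≤ N := by
    intro j hj; rw [← hNe]; exact_mod_cast hj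
  have hc0 : ∀ j : ℕ, (0:ℝ) ≤ j := fun j => Nat.cast_nonneg j
  constructor
  · apply hfin
    have hs : ∀ x ∈ Set.Icc (0:ℝ) (2 * Real.pi), |iteratedDeriv (p+1) u x| ≤ _ :=
      fun x hx => tre_agmon (hD p) (hp p).symm (hD (p+1)) (hDc _) hx
    have ht := tre_tri (hDc (p+1)) (hDc 2) (hDc (p+2)) (Real.sqrt_nonneg _) hs
    have e : (fun x => iteratedDeriv 2 u x * iteratedDeriv (p + 2 - 1) u x * iteratedDeriv (p + 2) u x)
      = fun x => iteratedDeriv (p+1) u x * (iteratedDeriv 2 u x * iteratedDeriv (p+2) u x) := by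
      ext x
      rw [show p + 2 - 1 = p + 1 by omega]; ring
    rw [e]
    refine ht.trans ?_
    refine tre_comb (hn0 _) (hn0 _) hNp (hc0 (p+1)) (hc0 (p+2)) (hc0 2) (hc0 (p+2))
      (hle _ (by omega)) (hle _ (by omega)) (hle _ (by omega)) (hle _ (by omega))
      (hn0 _) (hn0 _) (hn0 _) (hn0 _)
      (hint _ (by omega)) (hint _ (by omega)) (hint _ (by omega)) (hint _ (by omega)) d ?_
    rw [hd]; push_cast; field_simp; ring
  · apply hfin
    have hs : ∀ x ∈ Set.Icc (0:ℝ) (2 * Real.pi), |iteratedDeriv 1 u x| ≤ _ :=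
      fun x hx => tre_agmon (hD 0) (hp 0).symm (hD 1) (hDc _) hx
    have ht := tre_tri (hDc 1) (hDc (p+1)) (hDc (p+3)) (Real.sqrt_nonneg _) hs
    have e : (fun x => deriv u x * iteratedDeriv (p + 2 - 1) u x * iteratedDeriv (p + 2 + 1) u x)
      = fun x => iteratedDeriv 1 u x * (iteratedDeriv (p+1) u x * iteratedDeriv (p+3) u x) := by
      ext x
      rw [show p + 2 - 1 = p + 1 by omega, iteratedDeriv_one]; ring
    rw [e]
    refine ht.trans ?_
    refine tre_comb (hn0 _) (hn0 _) hNp (hc0 1) (hc0 2) (hc0 (p+1)) (hc0 (p+3))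
      (hle _ (by omega)) (hle _ (by omega)) (hle _ (by omega)) (hle _ (by omega))
      (hn0 _) (hn0 _) (hn0 _) (hn0 _)
      (hint _ (by omega)) (hint _ (by omega)) (hint _ (by omega)) (hint _ (by omega)) d ?_
    rw [hd]; push_cast; field_simp; ring
end

section
/- Let u : 𝕋 → ℝ be continuous with ∫_𝕋 u(x)dx = 0, and let (γ₁, γ₂) ∈ ℝ² be a nonzero vector such that the function γ₁·u + γ₂·u² is constant on 𝕋. Then u is identically zero. -/
open MeasureTheory Real Function intervalIntegral

/-- **Non-degeneracy of the pair `(u, u²)`.**  Let `u : 𝕋 → ℝ` be continuous (i.e. a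
continuous `2π`-periodic function on `ℝ`) with `∫_𝕋 u = 0`, and let `(γ₁, γ₂) ∈ ℝ²` be a
nonzero vector such that `γ₁·u + γ₂·u²` is constant on `𝕋`.  Then `u ≡ 0`. -/
theorem eq_zero_of_linear_combination_sq_const
    (u : ℝ → ℝ) (hu : Continuous u) (huper : Periodic u (2 * Real.pi))
    (humean : (∫ x in (0:ℝ)..(2 * Real.pi), u x) = 0)
    (γ : ℝ × ℝ) (hγ : γ ≠ 0)
    (hconst : ∃ c : ℝ, ∀ x : ℝ, γ.1 * u x + γ.2 * (u x) ^ 2 = c) :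
    ∀ x : ℝ, u x = 0 := by
  obtain ⟨c, hc⟩ := hconst
  have key : ∀ x y : ℝ, u x = u y := by
    intro x y
    by_contra hne
    have hm : (u x + u y) / 2 ∈ Set.uIcc (u x) (u y) := by
      rw [Set.mem_uIcc]
      rcases le_total (u x) (u y) with h | h
      · left; constructor <;> linarith
      · right; constructor <;> linarith
    obtain ⟨z, -, hz⟩ := intermediate_value_uIcc (hu.continuousOn (s := Set.uIcc x y)) hm
    have h1 := hc x
    have h2 := hc y
    have h3 := hc z
    rw [hz] at h3
    have hd : u x - u y ≠ 0 := sub_ne_zero.mpr hne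
    have h4 : γ.2 * (u x - u y) ^ 2 = 0 := by linear_combination 2 * h1 + 2 * h2 - 4 * h3
    have g2 : γ.2 = 0 := (mul_eq_zero.mp h4).resolve_right (pow_ne_zero 2 hd)
    have h5 : γ.1 * (u x - u y) = 0 := by
      rw [g2] at h1 h2
      linear_combination h1 - h2
    have g1 : γ.1 = 0 := (mul_eq_zero.mp h5).resolve_right hd
    exact hγ (Prod.ext g1 g2)
  intro x
  have hi : (∫ t in (0:ℝ)..(2 * Real.pi), u t) = ∫ _t in (0:ℝ)..(2 * Real.pi), u x := by
    congr 1
    funext t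
    exact key t x
  rw [humean, intervalIntegral.integral_const, smul_eq_mul, sub_zero] at hi
  exact (mul_eq_zero.mp hi.symm).resolve_left (by positivity)
end

section
/- Let (λ_m)_{m∈ℤ, m≠0} be real numbers with λ_m ≠ 0 for every m and Σ_{m≠0} λ_m² < ∞. Let (e_m)_{m≠0} be the orthonormal basis of mean-zero L²(𝕋) given by e_m(x) = sin(mx)/√π for m > 0 and e_m(x) = cos(mx)/√π for m < 0. For a continuous function u : 𝕋 → ℝ with ∫_𝕋 u(x)dx = 0, define the symmetric 2×2 matrix σ(u) by σ_{k,l}(u) = Σ_{m≠0} λ_m²·(∫_𝕋 u^k e_m dx)·(∫_𝕋 u^l e_m dx) for k, l ∈ {1,2}. If det σ(u) = 0, then u is identically zero. -/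
open MeasureTheory Real Function intervalIntegral

/-- The trigonometric orthonormal basis of mean-zero `L²(𝕋)`:
`e_m(x) = sin(mx)/√π` for `m > 0` and `e_m(x) = cos(mx)/√π` for `m < 0`. -/
noncomputable def trigBasis (m : ℤ) (x : ℝ) : ℝ :=
  if 0 < m then Real.sin (m * x) / Real.sqrt Real.pi
  else Real.cos (m * x) / Real.sqrt Real.pi

/-- The entries `σ_{k,l}(u) = Σ_{m≠0} λ_m²·(∫_𝕋 uᵏe_m)·(∫_𝕋 uˡe_m)` of the symmetric
matrix `σ(u)`. -/
noncomputable def sigmaEntry (lam : ℤ → ℝ) (u : ℝ → ℝ) (k l : ℕ) : ℝ :=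
  ∑' m : {m : ℤ // m ≠ 0},
    (lam (m : ℤ)) ^ 2 * (∫ x in (0:ℝ)..(2 * Real.pi), (u x) ^ k * trigBasis (m : ℤ) x) *
      (∫ x in (0:ℝ)..(2 * Real.pi), (u x) ^ l * trigBasis (m : ℤ) x)

lemma const_of_coeff (f : ℝ → ℝ) (hf : Continuous f) (hper : Periodic f (2 * Real.pi))
    (h : ∀ m : ℤ, m ≠ 0 → (∫ x in (0:ℝ)..(2 * Real.pi), f x * trigBasis m x) = 0) :
    ∀ x y, f x = f y := by
  have hsp : Real.sqrt Real.pi ≠ 0 := (Real.sqrt_pos.2 Real.pi_pos).ne'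
  have hs : ∀ m : ℤ, 0 < m → (∫ x in (0:ℝ)..(2 * Real.pi), f x * Real.sin (m * x)) = 0 := by
    intro m hm
    have h1 := h m hm.ne'
    simp only [trigBasis, if_pos hm, ← mul_div_assoc, intervalIntegral.integral_div] at h1
    simpa [hsp] using h1
  have hc : ∀ m : ℤ, m < 0 → (∫ x in (0:ℝ)..(2 * Real.pi), f x * Real.cos (m * x)) = 0 := by
    intro m hm
    have h1 := h m hm.ne
    simp only [trigBasis, if_neg hm.not_gt, ← mul_div_assoc, intervalIntegral.integral_div] at h1
    simpa [hsp] using h1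
  have hs' : ∀ m : ℤ, m ≠ 0 → (∫ x in (0:ℝ)..(2 * Real.pi), f x * Real.sin (m * x)) = 0 := by
    intro m hm
    rcases lt_or_gt_of_ne hm with h0 | h0
    · have := hs (-m) (by omega)
      simpa using this
    · exact hs m h0
  have hc' : ∀ m : ℤ, m ≠ 0 → (∫ x in (0:ℝ)..(2 * Real.pi), f x * Real.cos (m * x)) = 0 := by
    intro m hm
    rcases lt_or_gt_of_ne hm with h0 | h0
    · exact hc m h0
    · have := hc (-m) (by omega)
      simpa using this
  have : Fact (0 < 2 * Real.pi) := ⟨Real.two_pi_pos⟩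
  have hperC : Periodic (fun x => (f x : ℂ)) (2 * Real.pi) := fun x => by simp [hper x]
  let F : C(AddCircle (2 * Real.pi), ℂ) :=
    ⟨hperC.lift, continuous_coinduced_dom.mpr (by
      exact Complex.continuous_ofReal.comp hf)⟩
  have hF : ∀ x : ℝ, F (x : AddCircle (2 * Real.pi)) = (f x : ℂ) := fun x => hperC.lift_coe x
  have hcoef : ∀ n : ℤ, n ≠ 0 → fourierCoeff F n = 0 := by
    intro n hn
    rw [fourierCoeff_eq_intervalIntegral F n 0]
    have : ∀ x : ℝ, fourier (-n) (x : AddCircle (2 * Real.pi)) • F (x : AddCircle (2 * Real.pi))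
        = ((f x * Real.cos (n * x) : ℝ) : ℂ) - ((f x * Real.sin (n * x) : ℝ) : ℂ) * Complex.I := by
      intro x
      rw [hF, fourier_coe_apply]
      have e : 2 * (Real.pi : ℂ) * Complex.I * ((-n : ℤ) : ℂ) * x / ((2 * Real.pi : ℝ) : ℂ)
          = ((-(n * x) : ℝ) : ℂ) * Complex.I := by
        have : (Real.pi : ℂ) ≠ 0 := by exact_mod_cast Real.pi_ne_zero
        push_cast
        field_simp
      rw [e, Complex.exp_mul_I, ← Complex.ofReal_cos, ← Complex.ofReal_sin,
        Real.cos_neg, Real.sin_neg]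
      push_cast
      simp only [smul_eq_mul]
      ring
    simp only [this, zero_add]
    rw [intervalIntegral.integral_sub, intervalIntegral.integral_mul_const,
      intervalIntegral.integral_ofReal, intervalIntegral.integral_ofReal, hs' n hn, hc' n hn]
    · simp
    · exact Continuous.intervalIntegrable (by fun_prop) _ _
    · exact Continuous.intervalIntegrable (by fun_prop) _ _
  have hsm : Summable (fourierCoeff F) :=
    summable_of_ne_finset_zero (s := {0}) (fun n hn => hcoef n (by simpa using hn))
  have key : ∀ x : ℝ, (f x : ℂ) = fourierCoeff F 0 := by
    intro x
    have h1 := has_pointwise_sum_fourier_series_of_summable hsm (x : AddCircle (2 * Real.pi))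
    have h2 := hasSum_single (f := fun i => fourierCoeff F i • fourier i (x : AddCircle (2 * Real.pi)))
      0 (fun n hn => by simp [hcoef n hn])
    have h3 := h1.unique h2
    rw [hF] at h3
    simpa using h3
  intro x y
  have := (key x).trans (key y).symm
  exact_mod_cast this

lemma coeff_bound (f : ℝ → ℝ) (hf : Continuous f) :
    ∃ C, ∀ m, |∫ x in (0:ℝ)..(2 * Real.pi), f x * trigBasis m x| ≤ C := by
  obtain ⟨M, hM⟩ := (isCompact_uIcc (a := (0:ℝ)) (b := 2 * Real.pi)).exists_bound_of_continuousOn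
    hf.continuousOn
  refine ⟨M * (1 / Real.sqrt Real.pi) * |2 * Real.pi - 0|, fun m => ?_⟩
  rw [← Real.norm_eq_abs]
  refine intervalIntegral.norm_integral_le_of_norm_le_const fun x hx => ?_
  have h1 := hM x (Set.uIoc_subset_uIcc hx)
  rw [norm_mul]
  refine mul_le_mul h1 ?_ (norm_nonneg _) ((norm_nonneg _).trans h1)
  unfold trigBasis
  split_ifs
  · rw [norm_div, Real.norm_eq_abs, Real.norm_eq_abs, abs_of_nonneg (Real.sqrt_nonneg _)]
    gcongr
    exact Real.abs_sin_le_one _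
  · rw [norm_div, Real.norm_eq_abs, Real.norm_eq_abs, abs_of_nonneg (Real.sqrt_nonneg _)]
    gcongr
    exact Real.abs_cos_le_one _

lemma trig_cont (m : ℤ) : Continuous (trigBasis m) := by
  unfold trigBasis
  split_ifs <;> fun_prop

/-- **Degeneracy of the diffusion matrix forces `u = 0`.**  Let `(λ_m)_{m≠0}` be nonzero
reals with `Σ λ_m² < ∞`, and let `u : 𝕋 → ℝ` be continuous with mean zero.  If the
determinant of the `2×2` matrix `σ(u)` with entries
`σ_{k,l}(u) = Σ_{m≠0} λ_m²(∫ uᵏe_m)(∫ uˡe_m)`, `k,l ∈ {1,2}`, vanishes, then `u ≡ 0`. -/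
theorem eq_zero_of_det_sigma_eq_zero
    (lam : ℤ → ℝ) (hlam : ∀ m : ℤ, m ≠ 0 → lam m ≠ 0)
    (hsum : Summable (fun m : {m : ℤ // m ≠ 0} => (lam (m : ℤ)) ^ 2))
    (u : ℝ → ℝ) (hu : Continuous u) (huper : Periodic u (2 * Real.pi))
    (humean : (∫ x in (0:ℝ)..(2 * Real.pi), u x) = 0)
    (hdet : sigmaEntry lam u 1 1 * sigmaEntry lam u 2 2 -
      sigmaEntry lam u 1 2 * sigmaEntry lam u 2 1 = 0) :
    ∀ x : ℝ, u x = 0 := by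
  have hsm : ∀ k l, Summable (fun m : {m : ℤ // m ≠ 0} =>
      (lam (m : ℤ)) ^ 2 * (∫ x in (0:ℝ)..(2 * Real.pi), (u x) ^ k * trigBasis (m : ℤ) x) *
      (∫ x in (0:ℝ)..(2 * Real.pi), (u x) ^ l * trigBasis (m : ℤ) x)) := by
    intro k l
    obtain ⟨C, hC⟩ := coeff_bound (fun x => u x ^ k) (by fun_prop)
    obtain ⟨D, hD⟩ := coeff_bound (fun x => u x ^ l) (by fun_prop)
    refine Summable.of_norm_bounded (hsum.mul_right (C * D)) fun m => ?_
    rw [mul_assoc, norm_mul, norm_mul, Real.norm_of_nonneg (sq_nonneg _)]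
    exact mul_le_mul_of_nonneg_left (mul_le_mul (hC m) (hD m) (norm_nonneg _)
      ((abs_nonneg _).trans (hC m))) (sq_nonneg _)
  have hsymm : sigmaEntry lam u 2 1 = sigmaEntry lam u 1 2 := by
    unfold sigmaEntry
    exact tsum_congr fun m => by ring
  obtain ⟨α, β, hne, hq⟩ : ∃ α β : ℝ, (α ≠ 0 ∨ β ≠ 0) ∧
      α ^ 2 * sigmaEntry lam u 1 1 + 2 * α * β * sigmaEntry lam u 1 2
        + β ^ 2 * sigmaEntry lam u 2 2 = 0 := by
    rw [hsymm] at hdet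
    by_cases h0 : sigmaEntry lam u 1 1 = 0
    · exact ⟨1, 0, Or.inl one_ne_zero, by simp [h0]⟩
    · exact ⟨-sigmaEntry lam u 1 2, sigmaEntry lam u 1 1, Or.inr h0, by
        linear_combination sigmaEntry lam u 1 1 * hdet⟩
  have hS := (((hsm 1 1).hasSum.mul_left (α ^ 2)).add ((hsm 1 2).hasSum.mul_left (2 * α * β))).add
    ((hsm 2 2).hasSum.mul_left (β ^ 2))
  change HasSum _ (α ^ 2 * sigmaEntry lam u 1 1 + 2 * α * β * sigmaEntry lam u 1 2
        + β ^ 2 * sigmaEntry lam u 2 2) at hS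
  rw [hq] at hS
  have hS2 := hS.congr_fun (g := fun m : {m : ℤ // m ≠ 0} => (lam (m : ℤ) *
      (α * (∫ x in (0:ℝ)..(2 * Real.pi), (u x) ^ 1 * trigBasis (m : ℤ) x) +
      β * (∫ x in (0:ℝ)..(2 * Real.pi), (u x) ^ 2 * trigBasis (m : ℤ) x))) ^ 2)
      (fun m => by ring)
  rw [hasSum_zero_iff_of_nonneg (fun m => sq_nonneg _)] at hS2
  have hconst := const_of_coeff (fun x => α * u x + β * u x ^ 2) (by fun_prop)
    (fun x => by simp [huper x]) (by
      intro m hm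
      have h1 := congrFun hS2 ⟨m, hm⟩
      simp only [Pi.zero_apply, pow_eq_zero_iff two_ne_zero, mul_eq_zero, hlam m hm, false_or] at h1
      refine Eq.trans ?_ h1
      rw [← intervalIntegral.integral_const_mul, ← intervalIntegral.integral_const_mul,
        ← intervalIntegral.integral_add]
      · congr 1
        ext x
        ring
      · have := trig_cont m
        exact Continuous.intervalIntegrable (by fun_prop) _ _
      · have := trig_cont m
        exact Continuous.intervalIntegrable (by fun_prop) _ _)
  obtain ⟨x0, hx0⟩ : ∃ x0, u x0 = 0 := by
    by_contra! hcon
    have hsgn : (∀ x, 0 < u x) ∨ (∀ x, u x < 0) := by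
      by_contra! hh
      obtain ⟨⟨a, ha⟩, b, hb⟩ := hh
      obtain ⟨c, hc⟩ := mem_range_of_exists_le_of_exists_ge hu ⟨a, ha⟩ ⟨b, hb⟩
      exact hcon c hc
    rcases hsgn with hp | hn
    · have := intervalIntegral.intervalIntegral_pos_of_pos (hu.intervalIntegrable 0 (2 * Real.pi))
        hp Real.two_pi_pos
      linarith
    · have := intervalIntegral.intervalIntegral_pos_of_pos
        (hu.neg.intervalIntegrable 0 (2 * Real.pi)) (fun x => neg_pos.2 (hn x)) Real.two_pi_pos
      simp only [Pi.neg_apply, intervalIntegral.integral_neg] at this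
      linarith
  intro x
  by_contra hx
  obtain ⟨y, hy⟩ : ∃ y, u y = u x / 2 := by
    rcases lt_or_gt_of_ne hx with h0 | h0
    · exact mem_range_of_exists_le_of_exists_ge hu ⟨x, by linarith⟩ ⟨x0, by linarith⟩
    · exact mem_range_of_exists_le_of_exists_ge hu ⟨x0, by linarith⟩ ⟨x, by linarith⟩
  have e1 := hconst x x0
  have e2 := hconst y x0
  simp only [hx0, hy] at e1 e2
  have hb : β * u x ^ 2 = 0 := by linear_combination 2 * e1 - 4 * e2
  have hb' : β = 0 := by simpa [hx] using hb
  subst hb'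
  have ha' : α = 0 := by simpa [hx] using e1
  simp [ha'] at hne
end
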